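/- Let L be a cubic symmetric lamination and let G be a gap of L. Then either some forward image s3^n(G) (n ≥ 0) is a leaf or a single point, or G is preperiodic: there exist k ≥ 0 and p ≥ 1 such that s3^{k+p}(G) = s3^k(G). -/

import Mathlib

noncomputable section

open Set Metric

instance : Fact ((0:ℝ) < 1) := ⟨one_pos⟩

/-- The circle `S = ℝ/ℤ`. -/
abbrev S1 : Type := AddCircle (1 : ℝ)

/-- The tripling map `σ₃ : x ↦ 3x (mod 1)`. -/
def s3 : S1 → S1 := fun x => (3 : ℕ) • x

/-- The antipodal map `x ↦ x + 1/2` (denoted `−x` in the paper). -/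
def antip : S1 → S1 := fun x => x + (((1:ℝ)/2 : ℝ) : S1)

/-- A chord of the circle: an unordered pair of points of `S1`. -/
abbrev Chord : Type := Sym2 S1

/-- The image chord of a chord under a circle map. -/
def cmap (f : S1 → S1) (ℓ : Chord) : Chord := Sym2.map f ℓ

/-- The length of a chord `{a,b}`: the shorter of the two arcs joining `a` and `b`
(the natural norm on `ℝ/ℤ`). -/
def chordLen : Chord → ℝ :=
  Sym2.lift ⟨fun a b => ‖a - b‖, fun a b => norm_sub_rev a b⟩

/-- The standard embedding of the circle `ℝ/ℤ` into `ℂ` (onto the unit circle). -/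
def toC (x : S1) : ℂ :=
  Complex.exp (2 * Real.pi * Complex.I * (((AddCircle.equivIco 1 0 x : Set.Ico (0:ℝ) (0+1)) : ℝ) : ℂ))

/-- The geometric chord in the closed unit disk of `ℂ` determined by an
unordered pair of circle points. -/
def chordSet : Chord → Set ℂ :=
  Sym2.lift ⟨fun a b => segment ℝ (toC a) (toC b), fun a b => segment_symm ℝ _ _⟩

/-- Two chords cross if their endpoints strictly alternate on the circle. -/
def Crosses (ℓ₁ ℓ₂ : Chord) : Prop :=
  (∃ a b c d : ℝ, a < b ∧ b < c ∧ c < d ∧ d < a + 1 ∧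
    ℓ₁ = s(((a : ℝ) : S1), ((c : ℝ) : S1)) ∧ ℓ₂ = s(((b : ℝ) : S1), ((d : ℝ) : S1))) ∨
  (∃ a b c d : ℝ, a < b ∧ b < c ∧ c < d ∧ d < a + 1 ∧
    ℓ₂ = s(((a : ℝ) : S1), ((c : ℝ) : S1)) ∧ ℓ₁ = s(((b : ℝ) : S1), ((d : ℝ) : S1)))

/-- A critical chord: nondegenerate with degenerate `σ₃`-image. -/
def IsCritical (ℓ : Chord) : Prop := ¬ ℓ.IsDiag ∧ (cmap s3 ℓ).IsDiag

/-- The union in `ℂ` of all the chords of a family. -/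
def unionSet (L : Set Chord) : Set ℂ := ⋃ ℓ ∈ L, chordSet ℓ

def openDisk : Set ℂ := Metric.ball (0:ℂ) 1
def closedDisk : Set ℂ := Metric.closedBall (0:ℂ) 1

/-- A lamination: a family of pairwise non-crossing chords whose union is closed. -/
structure IsLamination (L : Set Chord) : Prop where
  nocross : ∀ ℓ₁ ∈ L, ∀ ℓ₂ ∈ L, ¬ Crosses ℓ₁ ℓ₂
  closed : IsClosed (unionSet L)

/-- A sibling collection: three pairwise disjoint chords with the same
nondegenerate `σ₃`-image. -/
def IsSiblingCollection (ℓ₁ ℓ₂ ℓ₃ : Chord) : Prop :=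
  Disjoint (chordSet ℓ₁) (chordSet ℓ₂) ∧ Disjoint (chordSet ℓ₁) (chordSet ℓ₃) ∧
  Disjoint (chordSet ℓ₂) (chordSet ℓ₃) ∧
  ¬ (cmap s3 ℓ₁).IsDiag ∧ cmap s3 ℓ₂ = cmap s3 ℓ₁ ∧ cmap s3 ℓ₃ = cmap s3 ℓ₁

/-- A `σ₃`-invariant lamination. -/
structure IsInvLam (L : Set Chord) extends IsLamination L : Prop where
  forward : ∀ ℓ ∈ L, cmap s3 ℓ ∈ L ∨ (cmap s3 ℓ).IsDiag
  backward : ∀ ℓ ∈ L, ∃ ℓ' ∈ L, cmap s3 ℓ' = ℓ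
  siblings : ∀ ℓ ∈ L, ¬ (cmap s3 ℓ).IsDiag →
    ∃ ℓ₂ ∈ L, ∃ ℓ₃ ∈ L, IsSiblingCollection ℓ ℓ₂ ℓ₃

/-- A cubic symmetric lamination. -/
structure IsCubicSymLam (L : Set Chord) extends IsInvLam L : Prop where
  symm : ∀ ℓ ∈ L, cmap antip ℓ ∈ L

/-- A major: a leaf whose length is closest to `1/3` among all leaves. -/
def IsMajor (L : Set Chord) (M : Chord) : Prop :=
  M ∈ L ∧ ∀ ℓ ∈ L, |1/3 - chordLen M| ≤ |1/3 - chordLen ℓ|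

/-- A minor: the `σ₃`-image of a major. -/
def IsMinor (L : Set Chord) (m : Chord) : Prop := ∃ M, IsMajor L M ∧ m = cmap s3 M

/-- A comajor: a short (or degenerate) sibling of a major, disjoint from all majors. -/
def IsComajor (L : Set Chord) (c : Chord) : Prop :=
  (chordLen c < 1/6 ∨ c.IsDiag) ∧ (¬ c.IsDiag → c ∈ L) ∧
  (∃ M, IsMajor L M ∧ cmap s3 c = cmap s3 M) ∧
  (∀ M, IsMajor L M → Disjoint (chordSet c) (chordSet M))

/-- The cubic symmetric comajor lamination: all comajors of all cubic symmetric
laminations. -/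
def CsCL : Set Chord := {c | ∃ L, IsCubicSymLam L ∧ IsComajor L c}

/-- A chord is periodic if some positive iterate of `σ₃` fixes it. -/
def ChordPeriodic (c : Chord) : Prop := ∃ p, 1 ≤ p ∧ cmap (s3^[p]) c = c

/-- A comajor is co-periodic if its image is periodic but it is not. -/
def CoPeriodic (c : Chord) : Prop := ChordPeriodic (cmap s3 c) ∧ ¬ ChordPeriodic c

/-- The point of the unit circle in `ℂ` with argument `2πt`. -/
def circPt (t : ℝ) : ℂ := toC ((t : ℝ) : S1)

/-- The (closed) arc of the circle in `ℂ` from angle `u` to angle `v` (traversed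
positively), as a subset of `ℂ`. -/
def arcSet (u v : ℝ) : Set ℂ := circPt '' Set.Icc u v

/-- The unordered arc between angles `u` and `v`. -/
def arcSetU (u v : ℝ) : Set ℂ := circPt '' Set.uIcc u v

/-- The closed region `R(n)` bounded by the chord from angle `a` to angle `a+t`
(with `t` the length of the chord) and the corresponding (shorter) arc `H(n)`:
the convex hull of that arc. -/
def regionUnder (a t : ℝ) : Set ℂ := convexHull ℝ (arcSet a (a + t))

/-- `Under m n` (`m ≺ n`): `m` is contained in the region `R(n)`. -/
def Under (m n : Chord) : Prop :=
  ∃ a t : ℝ, 0 ≤ t ∧ t < 1/2 ∧ t = chordLen n ∧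
    n = s(((a : ℝ) : S1), ((a + t : ℝ) : S1)) ∧ chordSet m ⊆ regionUnder a t

/-- The (closed) strip `C(ℓ)` between the medium/long chord `ℓ` from angle `a` to
angle `a+t` (with `1/6 < t ≤ 1/2` its length) and its medium/long sibling
`ℓ' = {a+1/3, a+t-1/3}`. -/
def stripSet (a t : ℝ) : Set ℂ :=
  convexHull ℝ (arcSetU (a + t) (a + 1/3) ∪ arcSetU (a + t - 1/3) a)

/-- The short strips `SH(ℓ) = C(ℓ) ∪ −C(ℓ)`. -/
def SHSet (a t : ℝ) : Set ℂ := stripSet a t ∪ stripSet (a + 1/2) t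

/-- For a short chord `c` from angle `a` to angle `a+t` (`0 ≤ t < 1/6`), the strip
`C(M_c)` between the two medium/long chords `M_c = {a+2/3, a+t+1/3}` and
`M'_c = {a+1/3, a+t+2/3}` having the same `σ₃`-image as `c`. -/
def QStrip (a t : ℝ) : Set ℂ :=
  convexHull ℝ (arcSet (a + 1/3) (a + t + 1/3) ∪ arcSet (a + 2/3) (a + t + 2/3))

/-- A legal (symmetric) pair `{c, −c}`. -/
def IsLegalPair (c : Chord) : Prop :=
  c.IsDiag ∨
  ∃ a t : ℝ, 0 < t ∧ t < 1/6 ∧ t = chordLen c ∧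
    c = s(((a : ℝ) : S1), ((a + t : ℝ) : S1)) ∧
    (∀ i j : ℕ,
      ¬ Crosses (cmap (s3^[i]) c) (cmap (s3^[j]) c) ∧
      ¬ Crosses (cmap (s3^[i]) c) (cmap (s3^[j]) (cmap antip c)) ∧
      ¬ Crosses (cmap (s3^[i]) (cmap antip c)) (cmap (s3^[j]) (cmap antip c))) ∧
    (∀ i : ℕ, 1 ≤ i →
      chordSet (cmap (s3^[i]) c) ∩ interior (QStrip a t ∪ QStrip (a + 1/2) t) = ∅)

/-- A gap of a lamination: the closure of a connected component of the complement,
in the open unit disk, of the union of the leaves. -/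
def IsGapOf (L : Set Chord) (G : Set ℂ) : Prop :=
  ∃ z ∈ openDisk \ unionSet L, G = closure (connectedComponentIn (openDisk \ unionSet L) z)

/-- The vertices of a gap: its points on the circle. -/
def gapVerts (G : Set ℂ) : Set S1 := {x : S1 | toC x ∈ G}

/-- The image of a gap: the convex hull of the `σ₃`-image of its vertex set. -/
def gapImage (G : Set ℂ) : Set ℂ := convexHull ℝ (toC '' (s3 '' gapVerts G))

/-- Iterated gap images. -/
def gapIter (n : ℕ) (G : Set ℂ) : Set ℂ := gapImage^[n] G

/-- An edge of a gap: a nondegenerate chord contained in its boundary. -/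
def IsEdgeOf (G : Set ℂ) (ℓ : Chord) : Prop := ¬ ℓ.IsDiag ∧ chordSet ℓ ⊆ frontier G

/-- The (first return) map `σ₃^p` on the gap `G` has degree greater than one:
some edge of the image gap has (at least) two disjoint preimage edges in `G`. -/
def GapDegreeGE2 (G : Set ℂ) (p : ℕ) : Prop :=
  ∃ m e₁ e₂ : Chord, IsEdgeOf (gapIter p G) m ∧ e₁ ≠ e₂ ∧
    IsEdgeOf G e₁ ∧ IsEdgeOf G e₂ ∧ Disjoint (chordSet e₁) (chordSet e₂) ∧
    cmap (s3^[p]) e₁ = m ∧ cmap (s3^[p]) e₂ = m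

/-- `L` has a periodic infinite gap of degree greater than one (hyperbolicity). -/
def HasHyperbolicGap (L : Set Chord) : Prop :=
  ∃ G p, IsGapOf L G ∧ (gapVerts G).Infinite ∧ 1 ≤ p ∧ gapIter p G = G ∧ GapDegreeGE2 G p

/-- Two circle points are joined by a finite concatenation of leaves of `L`. -/
def ChainJoined (L : Set Chord) : S1 → S1 → Prop :=
  Relation.ReflTransGen (fun x y => ∃ ℓ ∈ L, x ∈ ℓ ∧ y ∈ ℓ)

/-- A q-lamination: points joined by finite concatenations of leaves are vertices of
a single leaf or finite gap. -/
def IsQLam (L : Set Chord) : Prop :=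
  ∀ x y : S1, ChainJoined L x y →
    x = y ∨ (∃ ℓ ∈ L, x ∈ ℓ ∧ y ∈ ℓ) ∨
    (∃ G, IsGapOf L G ∧ (gapVerts G).Finite ∧ toC x ∈ G ∧ toC y ∈ G)

/-- A periodic point of `σ₃`. -/
def PerPt (x : S1) : Prop := ∃ p, 1 ≤ p ∧ s3^[p] x = x

/-- An eventually periodic point of `σ₃`. -/
def EvPerPt (x : S1) : Prop := ∃ k, PerPt (s3^[k] x)

/-- `x` is strictly preperiodic of preperiod `k ≥ 1` and period `p`. -/
def StrictPreper (x : S1) (k p : ℕ) : Prop :=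
  1 ≤ k ∧ 1 ≤ p ∧ s3^[p] (s3^[k] x) = s3^[k] x ∧
  (∀ j < k, ¬ PerPt (s3^[j] x)) ∧
  (∀ q, 1 ≤ q → s3^[q] (s3^[k] x) = s3^[k] x → p ≤ q)

/-- A periodic point of type B: of period `2n` with `σ₃ⁿ(x) = −x`. -/
def TypeB (x : S1) : Prop :=
  ∃ n, 1 ≤ n ∧ Function.minimalPeriod s3 x = 2 * n ∧ s3^[n] x = antip x

/-- `c` is a two-sided limit of chords of the family `A`: within every complementary
component of the disk minus `c` there are chords of `A` converging to `c`. -/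
def TwoSidedLimitOf (A : Set Chord) (c : Chord) : Prop :=
  ∀ z ∈ closedDisk \ chordSet c, ∀ ε : ℝ, 0 < ε →
    ∃ d ∈ A, d ≠ c ∧ chordSet d ⊆ connectedComponentIn (closedDisk \ chordSet c) z ∧
      Metric.hausdorffDist (chordSet d) (chordSet c) < ε

/-- The chord `n` weakly separates the chords `ℓ₁` and `ℓ₂`. -/
def WeaklySep (n ℓ₁ ℓ₂ : Chord) : Prop :=
  ∃ z₁ ∈ chordSet ℓ₁ \ chordSet n, ∃ z₂ ∈ chordSet ℓ₂ \ chordSet n,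
    chordSet ℓ₁ \ chordSet n ⊆ connectedComponentIn (closedDisk \ chordSet n) z₁ ∧
    chordSet ℓ₂ \ chordSet n ⊆ connectedComponentIn (closedDisk \ chordSet n) z₂ ∧
    connectedComponentIn (closedDisk \ chordSet n) z₁ ≠
      connectedComponentIn (closedDisk \ chordSet n) z₂

/-- The (non-diameter, non-fixed) chord `ℓ` moves in under the circle map `h`. -/
def MovesIn (h : S1 → S1) (ℓ : Chord) : Prop := cmap h ℓ ≠ ℓ ∧ Under (cmap h ℓ) ℓ

/-- The chord `ℓ` moves out under the circle map `h`. -/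
def MovesOut (h : S1 → S1) (ℓ : Chord) : Prop := cmap h ℓ ≠ ℓ ∧ ¬ Under (cmap h ℓ) ℓ

/-! ### Forward distance on the circle -/

/-- The length in `[0, 1)` of the positively oriented arc from `a` to `x`. -/
def fd (a x : S1) : ℝ := ((AddCircle.equivIco 1 0 (x - a) : Set.Ico (0:ℝ) (0+1)) : ℝ)

lemma fd_nonneg (a x : S1) : 0 ≤ fd a x := (AddCircle.equivIco 1 0 (x - a)).2.1

lemma fd_lt_one (a x : S1) : fd a x < 1 := by
  have := (AddCircle.equivIco 1 0 (x - a)).2.2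
  simpa [fd] using this

lemma coe_fd (a x : S1) : ((fd a x : ℝ) : S1) = x - a := AddCircle.coe_equivIco

lemma fd_eq_of {a x : S1} {r : ℝ} (h0 : 0 ≤ r) (h1 : r < 1) (h : (r : S1) = x - a) :
    fd a x = r := by
  unfold fd
  rw [← h, AddCircle.equivIco_coe_eq (by simpa using ⟨h0, h1⟩)]

lemma coe_eq_coe {r t : ℝ} (h : (r : S1) = (t : S1)) : ∃ k : ℤ, r = t + k := by
  rw [← sub_eq_zero, ← AddCircle.coe_sub, AddCircle.coe_eq_zero_iff] at h
  obtain ⟨n, hn⟩ := h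
  refine ⟨n, ?_⟩
  simp at hn
  linarith

lemma fd_add (a : S1) {r : ℝ} (h0 : 0 ≤ r) (h1 : r < 1) : fd a (a + (r : S1)) = r :=
  fd_eq_of h0 h1 (by abel)

lemma fd_self (a : S1) : fd a a = 0 := fd_eq_of le_rfl one_pos (by simp)

lemma eq_of_fd_eq_zero {a x : S1} (h : fd a x = 0) : x = a := by
  have := coe_fd a x
  rw [h, AddCircle.coe_zero] at this
  exact (sub_eq_zero.mp this.symm)

lemma fd_pos {a x : S1} (h : a ≠ x) : 0 < fd a x :=
  lt_of_le_of_ne (fd_nonneg a x) fun h' => h (eq_of_fd_eq_zero h'.symm).symm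

lemma ne_of_fd_pos {a x : S1} (h : 0 < fd a x) : a ≠ x := by
  rintro rfl
  simp [fd_self] at h

lemma fd_injective {a x y : S1} (h : fd a x = fd a y) : x = y := by
  have h1 := coe_fd a x
  rw [h, coe_fd a y] at h1
  exact (sub_left_inj.mp h1).symm

lemma fd_of_le {a b c : S1} (h : fd a b ≤ fd a c) : fd b c = fd a c - fd a b := by
  apply fd_eq_of (by linarith) (by linarith [fd_nonneg a b, fd_lt_one a c])
  rw [AddCircle.coe_sub, coe_fd, coe_fd]
  abel

lemma fd_of_lt {a b c : S1} (h : fd a c < fd a b) : fd b c = fd a c - fd a b + 1 := by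
  apply fd_eq_of (by linarith [fd_nonneg a c, fd_lt_one a b]) (by linarith)
  have h1 : ((1 : ℝ) : S1) = 0 := AddCircle.coe_period 1
  rw [AddCircle.coe_add, AddCircle.coe_sub, coe_fd, coe_fd, h1]
  abel

lemma fd_swap {a b : S1} (h : a ≠ b) : fd b a = 1 - fd a b := by
  have := fd_of_lt (a := a) (b := b) (c := a) (by rw [fd_self]; exact fd_pos h)
  rw [this, fd_self]; ring

lemma fd_congr {a x b y : S1} (h : x - a = y - b) : fd a x = fd b y := by
  unfold fd; rw [h]

/-- A point is determined by its position relative to a base point. -/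
lemma eq_add_fd (a x : S1) : x = a + (fd a x : S1) := by
  rw [coe_fd]; abel

lemma fd_s3 (u x : S1) :
    ∃ k : ℤ, 0 ≤ k ∧ k ≤ 2 ∧ fd u x = (fd (s3 u) (s3 x) + k) / 3 := by
  have h : ((fd (s3 u) (s3 x) : ℝ) : S1) = ((3 * fd u x : ℝ) : S1) := by
    have : ((3 * fd u x : ℝ) : S1) = (3 : ℕ) • ((fd u x : ℝ) : S1) := by
      rw [← AddCircle.coe_nsmul]; congr 1; simp
    rw [this, coe_fd, coe_fd, s3, s3, smul_sub]
  obtain ⟨k, hk⟩ := coe_eq_coe h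
  have h1 := fd_nonneg u x
  have h2 := fd_lt_one u x
  have h3 := fd_nonneg (s3 u) (s3 x)
  have h4 := fd_lt_one (s3 u) (s3 x)
  have hk1 : (-3 : ℝ) < k := by linarith
  have hk2 : (k : ℝ) < 1 := by linarith
  have hk1' : -3 < k := by exact_mod_cast hk1
  have hk2' : k < 1 := by exact_mod_cast hk2
  refine ⟨-k, by omega, by omega, ?_⟩
  push_cast
  linarith

lemma third_lt_iff {X W : ℝ} {k j : ℤ} (hX : 0 ≤ X) (hX1 : X < 1) (hW : 0 ≤ W) (hW1 : W < 1) :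
    (X + k) / 3 < (W + j) / 3 ↔ k < j ∨ (k = j ∧ X < W) := by
  constructor
  · intro h
    rcases lt_trichotomy k j with hkj | hkj | hkj
    · exact Or.inl hkj
    · subst hkj
      exact Or.inr ⟨rfl, by linarith⟩
    · have : (j : ℝ) + 1 ≤ k := by exact_mod_cast hkj
      linarith
  · rintro (h | ⟨rfl, h⟩)
    · have : (k : ℝ) + 1 ≤ j := by exact_mod_cast h
      linarith
    · linarith

lemma s3_continuous : Continuous s3 := by
  unfold s3; fun_prop

lemma s3_add_third (x : S1) {y : ℝ} : s3 (x + ((y / 3 : ℝ) : S1)) = s3 x + (y : S1) := by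
  unfold s3
  rw [smul_add, ← AddCircle.coe_nsmul]
  congr 2
  simp
  ring

lemma fiber_s3 {x y : S1} (h : s3 x = s3 y) (hne : x ≠ y) : fd x y = 1/3 ∨ fd x y = 2/3 := by
  obtain ⟨k, h0, h2, hk⟩ := fd_s3 x y
  have hp := fd_pos hne
  rw [h, fd_self] at hk
  interval_cases k
  · norm_num at hk; linarith
  · left; rw [hk]; norm_num
  · right; rw [hk]; norm_num

lemma finite_fiber_s3 (p : S1) : {x | s3 x = p}.Finite := by
  rcases Set.eq_empty_or_nonempty {x | s3 x = p} with h | ⟨x, hx⟩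
  · rw [h]; exact Set.finite_empty
  · have hf : ({0, 1/3, 2/3} : Set ℝ).Finite := by simp
    refine Set.Finite.of_finite_image (f := fd x) (hf.subset ?_) fun y _ z _ h => fd_injective h
    rintro _ ⟨y, hy, rfl⟩
    by_cases hxy : x = y
    · subst hxy; simp [fd_self]
    · rcases fiber_s3 (x := x) (y := y) (by rw [hx, hy]) hxy with h | h <;> simp [h]

/-! ### Sets not separated by leaves -/

/-- No leaf of `L` strictly separates two points of `A`. -/
def Unsep (L : Set Chord) (A : Set S1) : Prop :=
  ∀ p q, s(p, q) ∈ L → ∀ u ∈ A, ∀ v ∈ A, 0 < fd p u → fd p u < fd p q → fd p v ≤ fd p q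

/-- `a` and `b` are consecutive points of `A`, the positively oriented open arc from `a` to `b`
being free of points of `A`. -/
def Consec (A : Set S1) (a b : S1) : Prop :=
  a ∈ A ∧ b ∈ A ∧ a ≠ b ∧ ∀ x ∈ A, 0 < fd a x → fd a b ≤ fd a x

lemma crosses_of_fd {p q u v : S1} (h0 : 0 < fd p u) (h1 : fd p u < fd p q)
    (h2 : fd p q < fd p v) : Crosses s(p, q) s(u, v) := by
  obtain ⟨r, rfl⟩ := QuotientAddGroup.mk_surjective p
  refine Or.inl ⟨r, r + fd (r : S1) u, r + fd (r : S1) q, r + fd (r : S1) v, by linarith,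
    by linarith, by linarith, by linarith [fd_lt_one (r : S1) v], ?_, ?_⟩
  · rw [AddCircle.coe_add, ← eq_add_fd]
  · rw [AddCircle.coe_add, AddCircle.coe_add, ← eq_add_fd, ← eq_add_fd]

lemma IsLamination.unsep {L : Set Chord} (hL : IsLamination L) {u v : S1} (h : s(u, v) ∈ L) :
    Unsep L {u, v} := by
  rintro p q hpq x (rfl | rfl) y (rfl | rfl) h0 h1
  · exact h1.le
  · by_contra! h2
    exact hL.nocross _ hpq _ h (crosses_of_fd h0 h1 h2)
  · by_contra! h2
    exact hL.nocross _ hpq _ h (by rw [Sym2.eq_swap (a := y)]; exact crosses_of_fd h0 h1 h2)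
  · exact h1.le

/-- A symmetric form of non-separation, relative to a base point. -/
lemma Unsep.base {L : Set Chord} {A : Set S1} (h : Unsep L A) {p q : S1} (hpq : s(p, q) ∈ L)
    {u v : S1} (hu : u ∈ A) (hv : v ∈ A) (c : S1) (h1 : fd c p < fd c u) (h2 : fd c u < fd c q)
    (h3 : fd c v < fd c p ∨ fd c q < fd c v) : False := by
  have e1 := fd_of_le h1.le
  have e2 := fd_of_le (h1.trans h2).le
  have := h p q hpq u hu v hv (by linarith) (by linarith)
  rcases h3 with h3 | h3
  · rw [fd_of_lt h3] at this
    linarith [fd_lt_one c q, fd_nonneg c v]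
  · rw [fd_of_le (by linarith)] at this
    linarith

lemma toC_mem_chordSet_left (a b : S1) : toC a ∈ chordSet s(a, b) := left_mem_segment ℝ _ _

lemma toC_mem_chordSet_right (a b : S1) : toC b ∈ chordSet s(a, b) := right_mem_segment ℝ _ _

lemma exists_ordered_rep {p q : S1} {ℓ : Chord} (h : cmap s3 ℓ = s(p, q)) :
    ∃ a b, ℓ = s(a, b) ∧ s3 a = p ∧ s3 b = q := by
  induction ℓ using Sym2.ind with
  | _ a b =>
    rw [cmap, Sym2.map_mk] at h
    rcases Sym2.eq_iff.mp h with ⟨h1, h2⟩ | ⟨h1, h2⟩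
    · exact ⟨a, b, rfl, h1, h2⟩
    · exact ⟨b, a, Sym2.eq_swap, h2, h1⟩

lemma ne_of_disjoint_chordSet {a b a' b' : S1}
    (h : Disjoint (chordSet s(a, b)) (chordSet s(a', b'))) : a ≠ a' ∧ b ≠ b' := by
  rw [Set.disjoint_left] at h
  constructor
  · rintro rfl
    exact h (toC_mem_chordSet_left _ _) (toC_mem_chordSet_left _ _)
  · rintro rfl
    exact h (toC_mem_chordSet_right _ _) (toC_mem_chordSet_right _ _)

lemma IsInvLam.exists_siblings {L : Set Chord} (hL : IsInvLam L) {a b : S1} (h : s(a, b) ∈ L)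
    (hne : s3 a ≠ s3 b) :
    ∃ a₂ b₂ a₃ b₃, s(a₂, b₂) ∈ L ∧ s(a₃, b₃) ∈ L ∧ s3 a₂ = s3 a ∧ s3 a₃ = s3 a ∧
      s3 b₂ = s3 b ∧ s3 b₃ = s3 b ∧ a ≠ a₂ ∧ a ≠ a₃ ∧ a₂ ≠ a₃ ∧ b ≠ b₂ ∧ b ≠ b₃ ∧ b₂ ≠ b₃ := by
  obtain ⟨ℓ₂, h2, ℓ₃, h3, hd12, hd13, hd23, -, e2, e3⟩ := hL.siblings _ h
    (by simpa [cmap] using hne)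
  obtain ⟨a₂, b₂, rfl, ea2, eb2⟩ := exists_ordered_rep (e2.trans (Sym2.map_mk ..))
  obtain ⟨a₃, b₃, rfl, ea3, eb3⟩ := exists_ordered_rep (e3.trans (Sym2.map_mk ..))
  have h12 := ne_of_disjoint_chordSet hd12
  have h13 := ne_of_disjoint_chordSet hd13
  have h23 := ne_of_disjoint_chordSet hd23
  exact ⟨a₂, b₂, a₃, b₃, h2, h3, ea2, ea3, eb2, eb3, h12.1, h13.1, h23.1, h12.2, h13.2, h23.2⟩

lemma IsInvLam.leaf_image {L : Set Chord} (hL : IsInvLam L) {a b : S1} (h : s(a, b) ∈ L)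
    (hne : s3 a ≠ s3 b) : s(s3 a, s3 b) ∈ L := by
  rcases hL.forward _ h with h' | h'
  · simpa [cmap] using h'
  · exact absurd (by simpa [cmap] using h') hne

lemma Unsep.same_side {L : Set Chord} {A : Set S1} (h : Unsep L A) {u v p q : S1} (hu : u ∈ A)
    (hv : v ∈ A) (hpq : s(p, q) ∈ L) (hp : 0 < fd u p) (hq : 0 < fd u q) (hpv : fd u p ≠ fd u v)
    (hqv : fd u q ≠ fd u v) : fd u p < fd u v ↔ fd u q < fd u v := by
  constructor
  · intro h1
    by_contra! h2
    exact h.base hpq hv hu u h1 (lt_of_le_of_ne h2 (Ne.symm hqv)) (Or.inl (by rwa [fd_self]))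
  · intro h1
    by_contra! h2
    exact h.base (Sym2.eq_swap ▸ hpq) hv hu u h1 (lt_of_le_of_ne h2 (Ne.symm hpv))
      (Or.inl (by rwa [fd_self]))

lemma third_ne {X W : ℝ} {k j : ℤ} (hX : 0 ≤ X) (hX1 : X < 1) (hW : 0 ≤ W) (hW1 : W < 1)
    (h : X ≠ W) : (X + k) / 3 ≠ (W + j) / 3 := by
  intro e
  have h1 := third_lt_iff (k := k) (j := j) hX hX1 hW hW1
  have h2 := third_lt_iff (k := j) (j := k) hW hW1 hX hX1
  have h3 : ¬ (k < j ∨ (k = j ∧ X < W)) := fun hh => (h1.2 hh).ne e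
  have h4 : ¬ (j < k ∨ (j = k ∧ W < X)) := fun hh => (h2.2 hh).ne e.symm
  have hkj : k = j := by omega
  push Not at h3 h4
  exact h (le_antisymm (h4.2 hkj.symm) (h3.2 hkj))

theorem Unsep.image {L : Set Chord} (hL : IsInvLam L) {A : Set S1} (h : Unsep L A) :
    Unsep L (s3 '' A) := by
  rintro p q hpq _ ⟨u, hu, rfl⟩ _ ⟨v, hv, rfl⟩ h0 h1
  by_contra! h2
  obtain ⟨ℓ, hℓ, e⟩ := hL.backward _ hpq
  obtain ⟨a₁, b₁, rfl, rfl, rfl⟩ := exists_ordered_rep e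
  have hne : s3 a₁ ≠ s3 b₁ := ne_of_fd_pos (h0.trans h1)
  obtain ⟨a₂, b₂, a₃, b₃, l2, l3, ea2, ea3, eb2, eb3, na12, na13, na23, nb12, nb13, nb23⟩ :=
    hL.exists_siblings hℓ hne
  -- positions relative to `s3 u`
  have eX := fd_of_lt (a := s3 a₁) (b := s3 u) (c := s3 a₁) (by rwa [fd_self])
  rw [fd_self] at eX
  have eY := fd_of_le h1.le
  have eW := fd_of_le (h1.trans h2).le
  have lX := fd_lt_one (s3 u) (s3 a₁)
  have lY := fd_lt_one (s3 u) (s3 b₁)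
  have lW := fd_lt_one (s3 u) (s3 v)
  have lv := fd_lt_one (s3 a₁) (s3 v)
  set X := fd (s3 u) (s3 a₁)
  set Y := fd (s3 u) (s3 b₁)
  set W := fd (s3 u) (s3 v)
  have X0 : 0 < X := by linarith
  have Y0 : 0 < Y := by linarith
  have W0 : 0 < W := by linarith
  have hYW : Y < W := by linarith
  have hWX : W < X := by linarith
  obtain ⟨j, hj0, hj2, ej⟩ := fd_s3 u v
  have key : ∀ a b, s(a, b) ∈ L → s3 a = s3 a₁ → s3 b = s3 b₁ → ∃ k m : ℤ, 0 ≤ k ∧ k ≤ 2 ∧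
      0 ≤ m ∧ m ≤ 2 ∧ fd u a = (X + k) / 3 ∧ fd u b = (Y + m) / 3 ∧ (k < j ↔ m ≤ j) := by
    intro a b hab ea eb
    obtain ⟨k, hk0, hk2, ek⟩ := fd_s3 u a
    obtain ⟨m, hm0, hm2, em⟩ := fd_s3 u b
    rw [ea] at ek
    rw [eb] at em
    refine ⟨k, m, hk0, hk2, hm0, hm2, ek, em, ?_⟩
    have hk0' : (0 : ℝ) ≤ k := by exact_mod_cast hk0
    have hm0' : (0 : ℝ) ≤ m := by exact_mod_cast hm0
    have := h.same_side hu hv hab (by rw [ek]; linarith) (by rw [em]; linarith)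
      (by rw [ek, ej]; exact third_ne X0.le lX W0.le lW hWX.ne')
      (by rw [em, ej]; exact third_ne Y0.le lY W0.le lW hYW.ne)
    rw [ek, em, ej, third_lt_iff X0.le lX W0.le lW, third_lt_iff Y0.le lY W0.le lW] at this
    have n1 : ¬ X < W := not_lt.mpr hWX.le
    simp only [n1, hYW, and_false, or_false, and_true] at this
    omega
  obtain ⟨k₁, m₁, _, _, _, _, e1, f1, i1⟩ := key a₁ b₁ hℓ rfl rfl
  obtain ⟨k₂, m₂, _, _, _, _, e2, f2, i2⟩ := key a₂ b₂ l2 ea2 eb2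
  obtain ⟨k₃, m₃, _, _, _, _, e3, f3, i3⟩ := key a₃ b₃ l3 ea3 eb3
  have nk12 : k₁ ≠ k₂ := fun hh => na12 (fd_injective (a := u) (by rw [e1, e2, hh]))
  have nk13 : k₁ ≠ k₃ := fun hh => na13 (fd_injective (a := u) (by rw [e1, e3, hh]))
  have nk23 : k₂ ≠ k₃ := fun hh => na23 (fd_injective (a := u) (by rw [e2, e3, hh]))
  have nm12 : m₁ ≠ m₂ := fun hh => nb12 (fd_injective (a := u) (by rw [f1, f2, hh]))
  have nm13 : m₁ ≠ m₃ := fun hh => nb13 (fd_injective (a := u) (by rw [f1, f3, hh]))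
  have nm23 : m₂ ≠ m₃ := fun hh => nb23 (fd_injective (a := u) (by rw [f2, f3, hh]))
  omega

/-- The image of a pair of consecutive points spanning a leaf is consecutive, unless it
degenerates. -/
theorem Consec.image {L : Set Chord} (hL : IsInvLam L) {A : Set S1} (h : Unsep L A) {a b : S1}
    (hc : Consec A a b) (hab : s(a, b) ∈ L) (hne : s3 a ≠ s3 b) :
    Consec (s3 '' A) (s3 a) (s3 b) := by
  refine ⟨⟨a, hc.1, rfl⟩, ⟨b, hc.2.1, rfl⟩, hne, ?_⟩
  rintro _ ⟨w, hw, rfl⟩ W0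
  by_contra! hWB
  obtain ⟨a₂, b₂, a₃, b₃, l2, l3, ea2, ea3, eb2, eb3, na12, na13, na23, nb12, nb13, nb23⟩ :=
    hL.exists_siblings hab hne
  have lB := fd_lt_one (s3 a) (s3 b)
  set B := fd (s3 a) (s3 b)
  set W := fd (s3 a) (s3 w)
  have lW : W < 1 := hWB.trans lB
  have B0 : 0 < B := W0.trans hWB
  obtain ⟨j, hj0, hj2, ej⟩ := fd_s3 a w
  obtain ⟨m, hm0, hm2, em⟩ := fd_s3 a b
  have hj0' : (0 : ℝ) ≤ j := by exact_mod_cast hj0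
  have hwb := hc.2.2.2 w hw (by rw [ej]; linarith)
  have hmj : m < j := by
    by_contra! hjm
    have : (j : ℝ) ≤ m := by exact_mod_cast hjm
    rw [ej, em] at hwb
    linarith
  have key : ∀ a' b', s(a', b') ∈ L → s3 a' = s3 a → s3 b' = s3 b → a ≠ a' →
      ∃ k n : ℤ, 0 < k ∧ k ≤ 2 ∧ 0 ≤ n ∧ n ≤ 2 ∧ fd a a' = (0 + k) / 3 ∧
        fd a b' = (B + n) / 3 ∧ (k ≤ j ↔ n < j) := by
    intro a' b' hab' ea eb hne'
    obtain ⟨k, hk0, hk2, ek⟩ := fd_s3 a a'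
    obtain ⟨n, hn0, hn2, en⟩ := fd_s3 a b'
    rw [ea, fd_self] at ek
    rw [eb] at en
    have hp := fd_pos hne'
    have hk0' : 0 < k := by
      rw [ek] at hp
      have : (0 : ℝ) < k := by linarith
      exact_mod_cast this
    refine ⟨k, n, hk0', hk2, hn0, hn2, ek, en, ?_⟩
    have hn0' : (0 : ℝ) ≤ n := by exact_mod_cast hn0
    have := h.same_side hc.1 hw hab' hp (by rw [en]; linarith)
      (by rw [ek, ej]; exact third_ne le_rfl one_pos W0.le lW W0.ne)
      (by rw [en, ej]; exact third_ne B0.le lB W0.le lW hWB.ne')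
    rw [ek, en, ej, third_lt_iff le_rfl one_pos W0.le lW, third_lt_iff B0.le lB W0.le lW] at this
    have n1 : ¬ B < W := not_lt.mpr hWB.le
    simp only [n1, W0, and_false, or_false, and_true] at this
    omega
  obtain ⟨k₂, m₂, _, _, _, _, e2, f2, i2⟩ := key a₂ b₂ l2 ea2 eb2 na12
  obtain ⟨k₃, m₃, _, _, _, _, e3, f3, i3⟩ := key a₃ b₃ l3 ea3 eb3 na13
  have nk23 : k₂ ≠ k₃ := fun hh => na23 (fd_injective (a := a) (by rw [e2, e3, hh]))
  have nm12 : m ≠ m₂ := fun hh => nb12 (fd_injective (a := a) (by rw [em, f2, hh]))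
  have nm13 : m ≠ m₃ := fun hh => nb13 (fd_injective (a := a) (by rw [em, f3, hh]))
  have nm23 : m₂ ≠ m₃ := fun hh => nb23 (fd_injective (a := a) (by rw [f2, f3, hh]))
  omega

/-! ### Vertex sets of gaps, combinatorially -/

/-- The properties of the vertex set of a gap of `L` that are inherited by its images. -/
structure GapLike (L : Set Chord) (A : Set S1) : Prop where
  closed : IsClosed A
  unsep : Unsep L A
  leaf : ∀ a b, Consec A a b → s(a, b) ∈ L

/-- `A` has at least three points. -/
def HasThree (A : Set S1) : Prop := ∃ x ∈ A, ∃ y ∈ A, ∃ z ∈ A, x ≠ y ∧ x ≠ z ∧ y ≠ z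

lemma exists_consec_around {A : Set S1} (hA : IsClosed A) {x y z : S1} (hx : x ∉ A) (hy : y ∈ A)
    (hz : z ∈ A) (hyz : y ≠ z) : ∃ p q, Consec A p q ∧ 0 < fd p x ∧ fd p x < fd p q := by
  set T : Set ℝ := Icc 0 1 ∩ {t | x + (t : S1) ∈ A} with hT
  have hcT : IsCompact T := isCompact_Icc.inter_right
    (hA.preimage (continuous_const.add (AddCircle.continuous_mk' 1)))
  have mem : ∀ w ∈ A, fd x w ∈ T := fun w hw =>
    ⟨⟨fd_nonneg _ _, (fd_lt_one _ _).le⟩, by rw [mem_ofPred_eq, ← eq_add_fd]; exact hw⟩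
  obtain ⟨t₁, ht1, h1⟩ := hcT.exists_isLeast ⟨_, mem y hy⟩
  obtain ⟨t₂, ht2, h2⟩ := hcT.exists_isGreatest ⟨_, mem y hy⟩
  have p1 : 0 < t₁ := by
    refine lt_of_le_of_ne ht1.1.1 ?_
    rintro rfl
    exact hx (by simpa using ht1.2)
  have p2 : t₂ < 1 := by
    refine lt_of_le_of_ne ht2.1.2 ?_
    rintro rfl
    refine hx ?_
    have := ht2.2
    rwa [mem_ofPred_eq, AddCircle.coe_period, add_zero] at this
  have hlt : t₁ < t₂ := by
    have a1 := h1 (mem y hy)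
    have a2 := h1 (mem z hz)
    have a3 := h2 (mem y hy)
    have a4 := h2 (mem z hz)
    by_contra! hle
    exact hyz (fd_injective (a := x) (by linarith))
  have e2 : fd x (x + (t₂ : S1)) = t₂ := fd_add x (by linarith) p2
  have e1 : fd x (x + (t₁ : S1)) = t₁ := fd_add x p1.le (by linarith)
  have epq : fd (x + (t₂ : S1)) (x + (t₁ : S1)) = t₁ - t₂ + 1 := by
    rw [fd_of_lt (a := x) (by rw [e1, e2]; exact hlt), e1, e2]
  have epx : fd (x + (t₂ : S1)) x = 0 - t₂ + 1 := by
    rw [fd_of_lt (a := x) (by rw [e2, fd_self]; linarith), fd_self, e2]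
  refine ⟨x + (t₂ : S1), x + (t₁ : S1), ⟨ht2.2, ht1.2, ?_, ?_⟩, by linarith, by linarith⟩
  · intro h
    rw [← h, e2] at e1
    linarith
  · intro w hw hpos
    have l1 := h1 (mem w hw)
    have l2 := h2 (mem w hw)
    rcases l2.lt_or_eq with l2 | l2
    · rw [epq, fd_of_lt (a := x) (by rwa [e2]), e2]
      linarith
    · exact absurd (fd_injective (a := x) (by rw [l2, e2])) (ne_of_fd_pos hpos).symm

lemma Consec.right_unique {A : Set S1} {a b c : S1} (h : Consec A a b) (h' : Consec A a c) :
    b = c :=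
  fd_injective (le_antisymm (h.2.2.2 c h'.2.1 (fd_pos h'.2.2.1))
    (h'.2.2.2 b h.2.1 (fd_pos h.2.2.1)))

theorem GapLike.image {L : Set Chord} (hL : IsInvLam L) {A : Set S1} (h : GapLike L A) :
    GapLike L (s3 '' A) := by
  refine ⟨(h.closed.isCompact.image s3_continuous).isClosed, h.unsep.image hL, ?_⟩
  rintro _ _ ⟨⟨p₀, hp₀, rfl⟩, ⟨q', hq', rfl⟩, hne, hfree⟩
  obtain ⟨p', ⟨hp'A, hp'⟩, hmin⟩ := Set.exists_min_image {x | x ∈ A ∧ s3 x = s3 p₀}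
    (fun x => fd x q') ((finite_fiber_s3 (s3 p₀)).subset fun x hx => hx.2) ⟨p₀, hp₀, rfl⟩
  rw [← hp'] at hne hfree hmin ⊢
  have hpq' : p' ≠ q' := fun hh => hne (by rw [hh])
  set Q := fd (s3 p') (s3 q') with hQ
  have hQ0 : 0 < Q := fd_pos hne
  have hQ1 : Q < 1 := fd_lt_one _ _
  have hgap : ∀ w ∈ A, 0 < fd p' w → Q / 3 ≤ fd p' w := by
    intro w hw hpos
    by_contra! hlt
    obtain ⟨k, hk0, hk2, ek⟩ := fd_s3 p' w
    have hk0' : (0 : ℝ) ≤ k := by exact_mod_cast hk0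
    have hnn := fd_nonneg (s3 p') (s3 w)
    have hk : k = 0 := by
      have : (k : ℝ) < 1 := by linarith
      have : k < 1 := by exact_mod_cast this
      omega
    subst hk
    rw [Int.cast_zero] at ek
    have := hfree _ ⟨w, hw, rfl⟩ (by linarith)
    linarith
  have ex : fd p' (p' + ((Q / 6 : ℝ) : S1)) = Q / 6 := fd_add p' (by linarith) (by linarith)
  set x := p' + ((Q / 6 : ℝ) : S1)
  have hxA : x ∉ A := fun hx => by
    have := hgap x hx (by linarith)
    linarith
  obtain ⟨c, b, hcb, hc0, hc1⟩ := exists_consec_around h.closed hxA hp'A hq' hpq'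
  have hcp : c = p' := by
    by_contra hcp
    have h1 := hgap c hcb.1 (fd_pos (Ne.symm hcp))
    have e := fd_of_lt (a := p') (b := c) (c := p') (by rw [fd_self]; linarith)
    have e' := fd_of_lt (a := p') (b := c) (c := x) (by linarith)
    have := hcb.2.2.2 p' hp'A (fd_pos hcp)
    rw [fd_self] at e
    linarith
  subst hcp
  by_cases hb : s3 c = s3 b
  · exfalso
    have h1 := hcb.2.2.2 q' hq' (fd_pos hpq')
    have h2 := hmin b ⟨hcb.2.1, hb.symm⟩
    have h3 := fd_of_le h1
    have h4 := fd_pos hcb.2.2.1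
    linarith
  · have hl := h.leaf c b hcb
    have h1 := hcb.image hL h.unsep hl hb
    have h2 : Consec (s3 '' A) (s3 c) (s3 q') := ⟨h1.1, ⟨q', hq', rfl⟩, hne, hfree⟩
    rw [h2.right_unique h1]
    exact hL.leaf_image hl hb

/-- Two gap-like sets coincide, or one lies in a closed complementary arc of the other. -/
theorem GapLike.eq_or_unlinked {L : Set Chord} {A B : Set S1} (hA : GapLike L A)
    (hB : GapLike L B) (hA3 : HasThree A) (hB3 : HasThree B) :
    A = B ∨ ∃ p q, Consec A p q ∧ ∀ y ∈ B, fd p y ≤ fd p q := by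
  obtain ⟨a₁, ha1, a₂, ha2, -, -, ha12, -⟩ := hA3
  obtain ⟨b₁, hb1, b₂, hb2, b₃, hb3, hb12, hb13, hb23⟩ := hB3
  by_cases hBA : B ⊆ A
  · by_cases hAB : A ⊆ B
    · exact Or.inl (hAB.antisymm hBA)
    · exfalso
      obtain ⟨x, hxA, hxB⟩ := Set.not_subset.mp hAB
      obtain ⟨p, q, hc, h0, h1⟩ := exists_consec_around hB.closed hxB hb1 hb2 hb12
      have hy : ∀ y ∈ B, y = p ∨ y = q := by
        intro y hy
        have h2 := hA.unsep p q (hB.leaf p q hc) x hxA y (hBA hy) h0 h1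
        rcases eq_or_ne p y with rfl | hpy
        · exact Or.inl rfl
        · exact Or.inr (fd_injective (le_antisymm h2 (hc.2.2.2 y hy (fd_pos hpy))))
      rcases hy _ hb1 with h1 | h1 <;> rcases hy _ hb2 with h2 | h2 <;>
        rcases hy _ hb3 with h3 | h3 <;> simp_all
  · obtain ⟨x, hxB, hxA⟩ := Set.not_subset.mp hBA
    obtain ⟨p, q, hc, h0, h1⟩ := exists_consec_around hA.closed hxA ha1 ha2 ha12
    exact Or.inr ⟨p, q, hc, fun y hy => hB.unsep p q (hA.leaf p q hc) x hxB y hy h0 h1⟩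

/-- A set containing a nondegenerate arc eventually covers the circle. -/
lemma exists_image_eq_univ {A : Set S1} {a : S1} {r : ℝ} (hr : 0 < r)
    (h : ∀ x, fd a x ≤ r → x ∈ A) : ∃ n, s3^[n] '' A = univ := by
  have key : ∀ n : ℕ, ∀ y, fd (s3^[n] a) y ≤ 3 ^ n * r → y ∈ s3^[n] '' A := by
    intro n
    induction n with
    | zero => intro y hy; simpa using h y (by simpa using hy)
    | succ n ih =>
      intro y hy
      rw [Function.iterate_succ', Set.image_comp]
      rw [Function.iterate_succ', Function.comp] at hy
      have h0 := fd_nonneg (s3 (s3^[n] a)) y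
      have h1 := fd_lt_one (s3 (s3^[n] a)) y
      refine ⟨s3^[n] a + ((fd (s3 (s3^[n] a)) y / 3 : ℝ) : S1), ih _ ?_, ?_⟩
      · rw [fd_add _ (by linarith) (by linarith)]
        rw [pow_succ] at hy
        linarith
      · rw [s3_add_third, ← eq_add_fd]
  obtain ⟨n, hn⟩ := pow_unbounded_of_one_lt (1 / r) (by norm_num : (1 : ℝ) < 3)
  refine ⟨n, Set.eq_univ_of_forall fun y => key n y ?_⟩
  rw [div_lt_iff₀ hr] at hn
  linarith [fd_lt_one (s3^[n] a) y]

lemma s3_surjective : Function.Surjective s3 := fun y => by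
  refine ⟨0 + ((fd 0 y / 3 : ℝ) : S1), ?_⟩
  rw [s3_add_third]
  have : s3 0 = 0 := by simp [s3]
  rw [this, ← eq_add_fd]

/-- In a set without arcs there are consecutive points starting in `[x, y)`. -/
lemma exists_consec_from {A : Set S1} (hA : IsClosed A)
    (harc : ∀ a : S1, ∀ r > 0, ∃ x, fd a x ≤ r ∧ x ∉ A) {x y : S1} (hx : x ∈ A) (hy : y ∈ A)
    (hxy : x ≠ y) : ∃ a b, Consec A a b ∧ fd x a < fd x y := by
  obtain ⟨w, hw, hwA⟩ := harc x _ (half_pos (fd_pos hxy))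
  have hp := fd_pos hxy
  obtain ⟨a, b, hab, h0, h1⟩ := exists_consec_around hA hwA hx hy hxy
  refine ⟨a, b, hab, ?_⟩
  by_contra! hle
  have hxa : x ≠ a := ne_of_fd_pos (hp.trans_le hle)
  have e1 := fd_of_lt (a := x) (b := a) (c := w) (by linarith)
  have e2 := fd_swap hxa
  have e3 := hab.2.2.2 x hx (fd_pos hxa.symm)
  linarith [fd_nonneg x w]

/-- A gap-like set without arcs and with three points has three pairs of consecutive points. -/
lemma exists_three_consec {A : Set S1} (hA : IsClosed A)
    (harc : ∀ a : S1, ∀ r > 0, ∃ x, fd a x ≤ r ∧ x ∉ A) (h3 : HasThree A) :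
    ∃ a b : Fin 3 → S1, Function.Injective a ∧ ∀ i, Consec A (a i) (b i) := by
  have main : ∀ x ∈ A, ∀ y ∈ A, ∀ z ∈ A, 0 < fd x y → fd x y < fd x z →
      ∃ a b : Fin 3 → S1, Function.Injective a ∧ ∀ i, Consec A (a i) (b i) := by
    intro x hx y hy z hz h0 h1
    have hyz : y ≠ z := by rintro rfl; exact lt_irrefl _ h1
    have hzx : z ≠ x := by rintro rfl; rw [fd_self] at h1; linarith
    obtain ⟨a₁, b₁, c1, l1⟩ := exists_consec_from hA harc hx hy (ne_of_fd_pos h0)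
    obtain ⟨a₂, b₂, c2, l2⟩ := exists_consec_from hA harc hy hz hyz
    obtain ⟨a₃, b₃, c3, l3⟩ := exists_consec_from hA harc hz hx hzx
    rw [fd_of_le h1.le] at l2
    have e2 : fd x y ≤ fd x a₂ ∧ fd x a₂ < fd x z := by
      rcases le_or_gt (fd x y) (fd x a₂) with h | h
      · rw [fd_of_le h] at l2
        exact ⟨h, by linarith⟩
      · rw [fd_of_lt h] at l2
        linarith [fd_nonneg x a₂, fd_lt_one x z]
    have e3 : fd x z ≤ fd x a₃ := by
      by_contra! h
      rw [fd_of_lt h, fd_swap hzx.symm] at l3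
      linarith [fd_nonneg x a₃]
    have n12 : a₁ ≠ a₂ := by rintro rfl; linarith
    have n13 : a₁ ≠ a₃ := by rintro rfl; linarith
    have n23 : a₂ ≠ a₃ := by rintro rfl; linarith
    refine ⟨![a₁, a₂, a₃], ![b₁, b₂, b₃], ?_, ?_⟩
    · intro i j hij
      fin_cases i <;> fin_cases j <;> simp_all
    · intro i
      fin_cases i <;> simpa
  obtain ⟨x, hx, y, hy, z, hz, hxy, hxz, hyz⟩ := h3
  rcases lt_trichotomy (fd x y) (fd x z) with h | h | h
  · exact main x hx y hy z hz (fd_pos hxy) h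
  · exact absurd (fd_injective h) hyz
  · exact main x hx z hz y hy (fd_pos hxz) h

/-! ### Pigeonhole arguments -/

lemma fd_cases (a b c : S1) : (fd a b ≤ fd a c ∧ fd b c = fd a c - fd a b) ∨
    (fd a c < fd a b ∧ fd b c = fd a c - fd a b + 1) := by
  rcases le_or_gt (fd a b) (fd a c) with h | h
  · exact Or.inl ⟨h, fd_of_le h⟩
  · exact Or.inr ⟨h, fd_of_lt h⟩

/-- The index of the arc containing `x` in a partition of the circle into `M + 1` equal arcs. -/
def bin (M : ℕ) (x : S1) : Fin (M + 1) :=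
  ⟨⌊(M + 1 : ℝ) * fd 0 x⌋₊, by
    have h0 := fd_nonneg 0 x
    have h1 := fd_lt_one 0 x
    have hM : (0 : ℝ) < M + 1 := by positivity
    rw [Nat.floor_lt (by positivity)]
    push_cast
    nlinarith⟩

lemma fd_lt_of_bin_eq {M : ℕ} {x y : S1} (h : bin M x = bin M y) :
    fd x y < 1 / (M + 1) ∨ fd y x < 1 / (M + 1) := by
  have hM : (0 : ℝ) < M + 1 := by positivity
  have h' : ⌊(M + 1 : ℝ) * fd 0 x⌋₊ = ⌊(M + 1 : ℝ) * fd 0 y⌋₊ := congrArg Fin.val h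
  have hx := Nat.floor_le (mul_nonneg hM.le (fd_nonneg 0 x))
  have hy := Nat.floor_le (mul_nonneg hM.le (fd_nonneg 0 y))
  have hx' := Nat.lt_floor_add_one ((M + 1 : ℝ) * fd 0 x)
  have hy' := Nat.lt_floor_add_one ((M + 1 : ℝ) * fd 0 y)
  rw [h'] at hx hx'
  rw [lt_div_iff₀ hM, lt_div_iff₀ hM]
  rcases le_total (fd 0 x) (fd 0 y) with hle | hle
  · left
    rw [fd_of_le hle]
    linarith
  · right
    rw [fd_of_le hle]
    linarith

lemma HasThree.exists_third {A : Set S1} (h : HasThree A) (u v : S1) :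
    ∃ z ∈ A, z ≠ u ∧ z ≠ v := by
  obtain ⟨x, hx, y, hy, z, hz, hxy, hxz, hyz⟩ := h
  by_contra! hh
  have h1 := hh x hx
  have h2 := hh y hy
  have h3 := hh z hz
  by_cases hxu : x = u <;> by_cases hyu : y = u <;> by_cases hzu : z = u <;> simp_all

lemma Consec.le_or_eq {A : Set S1} {p q x : S1} (h : Consec A p q) (hx : x ∈ A) :
    fd p x = 0 ∨ fd p q ≤ fd p x := by
  rcases (fd_nonneg p x).eq_or_lt with h0 | h0
  · exact Or.inl h0.symm
  · exact Or.inr (h.2.2.2 x hx h0)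

/-- Unlinked sets containing nearby pairs at distance `1/3` share this pair and lie on different
sides of it. -/
lemma critical_pair_sides {A B : Set S1} (hA3 : HasThree A) (hB3 : HasThree B) {p q : S1}
    (hc : Consec A p q) (hB : ∀ y ∈ B, fd p y ≤ fd p q) {x x' y y' : S1} (hx : x ∈ A)
    (hx' : x' ∈ A) (hy : y ∈ B) (hy' : y' ∈ B) (hxx : fd x x' = 1 / 3) (hyy : fd y y' = 1 / 3)
    (hxy : fd x y < 1 / 3 ∨ fd y x < 1 / 3) :
    (∃ z ∈ A, 0 < fd x z ∧ fd x z < 1 / 3) ↔ ¬ ∃ z ∈ B, 0 < fd y z ∧ fd y z < 1 / 3 := by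
  have hQ := fd_pos hc.2.2.1
  have hQ1 := fd_lt_one p q
  have a1 := hc.le_or_eq hx
  have a2 := hc.le_or_eq hx'
  have a3 := hB y hy
  have a4 := hB y' hy'
  have x0 := fd_nonneg p x
  have x0' := fd_nonneg p x'
  have y0 := fd_nonneg p y
  have y0' := fd_nonneg p y'
  have x1 := fd_lt_one p x
  have x1' := fd_lt_one p x'
  have c1 := fd_cases p x x'
  have c2 := fd_cases p y y'
  have c3 := fd_cases p x y
  have c4 := fd_cases p y x
  rw [hxx] at c1
  rw [hyy] at c2
  have exy : x = y := by
    refine fd_injective (a := p) (le_antisymm ?_ ?_) <;> by_contra! hlt <;>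
    rcases c1 with ⟨c1, d1⟩ | ⟨c1, d1⟩ <;> rcases c2 with ⟨c2, d2⟩ | ⟨c2, d2⟩ <;>
    rcases c3 with ⟨c3, d3⟩ | ⟨c3, d3⟩ <;> rcases c4 with ⟨c4, d4⟩ | ⟨c4, d4⟩ <;>
    rcases a1 with a1 | a1 <;> rcases a2 with a2 | a2 <;> rcases hxy with hxy | hxy <;> linarith
  subst exy
  have exy' : x' = y' := fd_injective (hxx.trans hyy.symm)
  subst exy'
  have hpair : (x = p ∧ x' = q) ∨ (x = q ∧ x' = p) := by
    have hxx' : x ≠ x' := ne_of_fd_pos (by rw [hxx]; norm_num)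
    rcases a1 with a1 | a1
    · have := eq_of_fd_eq_zero a1
      subst this
      rcases a2 with a2 | a2
      · exact absurd (eq_of_fd_eq_zero a2).symm hxx'
      · exact Or.inl ⟨rfl, fd_injective (le_antisymm a4 a2)⟩
    · have := fd_injective (le_antisymm a3 a1)
      subst this
      rcases a2 with a2 | a2
      · exact Or.inr ⟨rfl, eq_of_fd_eq_zero a2⟩
      · exact absurd (fd_injective (le_antisymm a2 a4)) hxx'.symm.symm
  rcases hpair with ⟨rfl, rfl⟩ | ⟨rfl, rfl⟩
  · have hl : ¬ ∃ z ∈ A, 0 < fd x z ∧ fd x z < 1 / 3 := by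
      rintro ⟨z, hz, h0, h1⟩
      have := hc.2.2.2 z hz h0
      linarith
    have hr : ∃ z ∈ B, 0 < fd x z ∧ fd x z < 1 / 3 := by
      obtain ⟨z, hz, hz1, hz2⟩ := hB3.exists_third x x'
      refine ⟨z, hz, fd_pos hz1.symm, ?_⟩
      rw [← hxx]
      exact lt_of_le_of_ne (hB z hz) fun h => hz2 (fd_injective h)
    exact iff_of_false hl (not_not.mpr hr)
  · have hs := fd_swap hc.2.2.1
    have hl : ∃ z ∈ A, 0 < fd x z ∧ fd x z < 1 / 3 := by
      obtain ⟨z, hz, hz1, hz2⟩ := hA3.exists_third x x'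
      refine ⟨z, hz, fd_pos hz1.symm, ?_⟩
      rw [fd_of_le (hc.2.2.2 z hz (fd_pos hz2.symm))]
      linarith [fd_lt_one x' z]
    have hr : ¬ ∃ z ∈ B, 0 < fd x z ∧ fd x z < 1 / 3 := by
      rintro ⟨z, hz, h0, h1⟩
      have := hB z hz
      rcases fd_cases x' x z with ⟨h2, h3⟩ | ⟨h2, h3⟩
      · linarith
      · linarith [fd_nonneg x' z]
    exact iff_of_true hl hr

/-- A gap that never repeats and never collapses eventually contains no critical pair. -/
theorem eventually_injOn {L : Set Chord} {A : ℕ → Set S1} (hA : ∀ n, GapLike L (A n))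
    (h3 : ∀ n, HasThree (A n)) (hinj : Function.Injective A) :
    ∃ N, ∀ n ≥ N, InjOn s3 (A n) := by
  by_contra! hN
  set I : Set ℕ := {n | ¬ InjOn s3 (A n)}
  have hI : I.Infinite := Set.infinite_of_not_bddAbove fun ⟨b, hb⟩ => by
    obtain ⟨n, hn, hn'⟩ := hN (b + 1)
    have : n ≤ b := hb hn'
    omega
  have hpair : ∀ n : I, ∃ x ∈ A n, ∃ y ∈ A n, fd x y = 1 / 3 := by
    rintro ⟨n, hn⟩
    have hn' : ¬ InjOn s3 (A n) := hn
    simp only [InjOn] at hn'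
    push Not at hn'
    obtain ⟨x, hx, y, hy, he, hne⟩ := hn'
    rcases fiber_s3 he hne with h | h
    · exact ⟨x, hx, y, hy, h⟩
    · exact ⟨y, hy, x, hx, by rw [fd_swap hne, h]; norm_num⟩
  choose x hx y hy hxy using hpair
  have := hI.to_subtype
  obtain ⟨n, m, hnm, heq⟩ := Finite.exists_ne_map_eq_of_infinite
    fun n : I => (bin 2 (x n), (∃ z ∈ A n, 0 < fd (x n) z ∧ fd (x n) z < 1 / 3))
  obtain ⟨h1, h2⟩ := Prod.mk.inj heq
  have hclose := fd_lt_of_bin_eq h1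
  norm_num at hclose
  rcases (hA n).eq_or_unlinked (hA m) (h3 n) (h3 m) with h | ⟨p, q, hc, hB⟩
  · exact hnm (Subtype.ext (hinj h))
  · have := critical_pair_sides (h3 n) (h3 m) hc hB (hx n) (hy n) (hx m) (hy m) (hxy n) (hxy m)
      (by simpa using hclose)
    rw [h2] at this
    exact iff_not_self this

/-- The length of the chord joining two points, given by its shorter arc. -/
def len (a b : S1) : ℝ := min (fd a b) (1 - fd a b)

lemma len_comm (a b : S1) : len a b = len b a := by
  rcases eq_or_ne a b with rfl | h
  · rfl
  · unfold len
    rw [fd_swap h, min_comm]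
    congr 1
    ring

lemma Consec.len_le_fd {A : Set S1} {a b x : S1} (h : Consec A a b) (hx : x ∈ A) (hax : a ≠ x) :
    len a b ≤ fd a x :=
  (min_le_left _ _).trans (h.2.2.2 x hx (fd_pos hax))

/-- Distinct unlinked gaps cannot have edges that are long and close to each other. -/
theorem exists_short_edge {L : Set Chord} {A : ℕ → Set S1} (hA : ∀ n, GapLike L (A n))
    (h3 : ∀ n, HasThree (A n)) (hinj : Function.Injective A) {a b : ℕ → Fin 3 → S1}
    (ha : ∀ n, Function.Injective (a n)) (hab : ∀ n i, Consec (A n) (a n i) (b n i))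
    {ε : ℝ} (hε : 0 < ε) : ∃ n i, len (a n i) (b n i) < ε := by
  by_contra! hlen
  obtain ⟨M, hM⟩ := exists_nat_one_div_lt hε
  obtain ⟨n, m, hnm, heq⟩ := Finite.exists_ne_map_eq_of_infinite
    fun n : ℕ => fun i => bin M (a n i)
  rcases (hA n).eq_or_unlinked (hA m) (h3 n) (h3 m) with h | ⟨p, q, hc, hB⟩
  · exact hnm (hinj h)
  have hQ := fd_pos hc.2.2.1
  have hQ1 := fd_lt_one p q
  have hside : ∀ i, fd p (a m i) < ε ∨ fd p q - ε < fd p (a m i) := by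
    intro i
    have h1 := fd_lt_of_bin_eq (congrFun heq i)
    have h2 := hB _ (hab m i).1
    have h4 := hc.le_or_eq (hab n i).1
    have c1 := fd_cases p (a n i) (a m i)
    have c2 := fd_cases p (a m i) (a n i)
    by_contra! h5
    have := fd_nonneg p (a m i)
    have := fd_lt_one p (a n i)
    rcases c1 with ⟨c1, d1⟩ | ⟨c1, d1⟩ <;> rcases c2 with ⟨c2, d2⟩ | ⟨c2, d2⟩ <;>
    rcases h4 with h4 | h4 <;> rcases h1 with h1 | h1 <;> linarith
  have hsep : ∀ i j, i ≠ j → ε ≤ |fd p (a m i) - fd p (a m j)| := by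
    intro i j hij
    have h1 := (hlen m i).trans ((hab m i).len_le_fd (hab m j).1 fun h => hij (ha m h))
    have h2 := (hlen m j).trans ((hab m j).len_le_fd (hab m i).1 fun h => hij (ha m h).symm)
    rcases le_total (fd p (a m i)) (fd p (a m j)) with h | h
    · rw [fd_of_le h] at h1
      rw [abs_sub_comm]
      exact h1.trans (le_abs_self _)
    · rw [fd_of_le h] at h2
      exact h2.trans (le_abs_self _)
  have hpig : ∃ i j : Fin 3, i ≠ j ∧
      (fd p (a m i) < ε ↔ fd p (a m j) < ε) := by
    by_cases h0 : fd p (a m 0) < ε <;> by_cases h1 : fd p (a m 1) < ε <;>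
    by_cases h2 : fd p (a m 2) < ε
    all_goals first
      | exact ⟨0, 1, by decide, iff_of_true h0 h1⟩
      | exact ⟨0, 1, by decide, iff_of_false h0 h1⟩
      | exact ⟨0, 2, by decide, iff_of_true h0 h2⟩
      | exact ⟨0, 2, by decide, iff_of_false h0 h2⟩
      | exact ⟨1, 2, by decide, iff_of_true h1 h2⟩
      | exact ⟨1, 2, by decide, iff_of_false h1 h2⟩
  obtain ⟨i, j, hij, hiff⟩ := hpig
  have h := hsep i j hij
  have i1 := hB _ (hab m i).1
  have j1 := hB _ (hab m j).1
  have i0 := fd_nonneg p (a m i)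
  have j0 := fd_nonneg p (a m j)
  by_cases hi : fd p (a m i) < ε
  · have hj := hiff.1 hi
    exact absurd h (not_le.mpr (abs_lt.mpr ⟨by linarith, by linarith⟩))
  · have hi' := (hside i).resolve_left hi
    have hj' := (hside j).resolve_left fun hj => hi (hiff.2 hj)
    exact absurd h (not_le.mpr (abs_lt.mpr ⟨by linarith, by linarith⟩))

/-! ### The central strip argument -/

lemma strip_positions {d U V : ℝ} (hd : 0 < d) (hd6 : d < 1 / 6) (hU : 0 ≤ U)
    (hV : V < 1) (h1 : |min (V - U) (1 - (V - U)) - 1 / 3| < d)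
    (c1 : ∀ s t : ℝ, (s = 0 ∧ t = 1 / 3 + d) ∨ (s = d ∧ t = 1 / 3) ∨
      (s = 1 / 2 ∧ t = 5 / 6 + d) ∨ (s = 1 / 2 + d ∧ t = 5 / 6) →
      ¬ (s < U ∧ U < t ∧ t < V) ∧ ¬ (U < s ∧ s < V ∧ V < t)) :
    (U ≤ d ∧ 1 / 3 ≤ V ∧ V ≤ 1 / 3 + d) ∨
      (1 / 2 ≤ U ∧ U ≤ 1 / 2 + d ∧ 5 / 6 ≤ V ∧ V ≤ 5 / 6 + d) := by
  obtain ⟨a1, a2⟩ := c1 _ _ (Or.inl ⟨rfl, rfl⟩)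
  obtain ⟨b1, b2⟩ := c1 _ _ (Or.inr (Or.inl ⟨rfl, rfl⟩))
  obtain ⟨e1, e2⟩ := c1 _ _ (Or.inr (Or.inr (Or.inl ⟨rfl, rfl⟩)))
  obtain ⟨f1, f2⟩ := c1 _ _ (Or.inr (Or.inr (Or.inr ⟨rfl, rfl⟩)))
  have hlen : (1 / 3 - d < V - U ∧ V - U < 1 / 3 + d) ∨
      (2 / 3 - d < V - U ∧ V - U < 2 / 3 + d) := by
    rw [abs_lt] at h1
    rcases min_choice (V - U) (1 - (V - U)) with h | h <;> rw [h] at h1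
    · exact Or.inl ⟨by linarith, by linarith⟩
    · exact Or.inr ⟨by linarith, by linarith⟩
  clear h1 c1
  simp only [not_and, not_lt] at a1 a2 b1 b2 e1 e2 f1 f2
  grind (splits := 40)

lemma Unsep.subset_strip {L : Set Chord} {B : Set S1} (h : Unsep L B) {c : S1} {d : ℝ}
    (hd : 0 < d) (hd6 : d < 1 / 6) (l1 : s(c, c + ((1 / 3 + d : ℝ) : S1)) ∈ L)
    (l2 : s(c + (d : S1), c + ((1 / 3 : ℝ) : S1)) ∈ L) {u v : S1} (hu : u ∈ B) (hv : v ∈ B)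
    (hU : fd c u ≤ d) (hV : 1 / 3 ≤ fd c v)
    (hlt : fd c v - fd c u < 1 / 3 + d) (hgt : 1 / 3 - d < fd c v - fd c u) :
    ∀ x ∈ B, fd c x ≤ d ∨ fd (c + ((1 / 3 : ℝ) : S1)) x ≤ d := by
  intro x hx
  have p1 := fd_add c (r := 1 / 3 + d) (by linarith) (by linarith)
  have p2 := fd_add c (r := d) (by linarith) (by linarith)
  have p3 := fd_add c (r := 1 / 3) (by linarith) (by linarith)
  have hU0 := fd_nonneg c u
  by_contra! hcon
  obtain ⟨h1, h2⟩ := hcon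
  rcases lt_or_ge (fd c x) (1 / 3) with h3 | h3
  · refine h.base l2 hx hu c (by rwa [p2]) (by rwa [p3]) (Or.inl ?_)
    rw [p2]
    by_contra! h4
    refine h.base l2 hx hv c (by rwa [p2]) (by rwa [p3]) (Or.inr ?_)
    rw [p3]
    linarith
  · rw [fd_of_le (a := c) (by rwa [p3]), p3] at h2
    refine h.base l1 hu hx c ?_ (by rw [p1]; linarith) (Or.inr (by rw [p1]; linarith))
    rw [fd_self]
    by_contra! h4
    refine h.base l1 hv hx c (by rw [fd_self]; linarith) (by rw [p1]; linarith)
      (Or.inr (by rw [p1]; linarith))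

lemma exists_strip {L : Set Chord} (hL : IsCubicSymLam L) {a b : S1} (hab : s(a, b) ∈ L)
    {d : ℝ} (hd : |len a b - 1 / 3| = d) (h0 : 0 < d) (h6 : d < 1 / 6) :
    ∃ c : S1, s(c, c + ((1 / 3 + d : ℝ) : S1)) ∈ L ∧
      s(c + (d : S1), c + ((1 / 3 : ℝ) : S1)) ∈ L := by
  wlog hf : fd a b ≤ 1 / 2 generalizing a b
  · refine this (a := b) (b := a) (by rwa [Sym2.eq_swap]) (by rwa [len_comm]) ?_
    push Not at hf
    rw [fd_swap (ne_of_fd_pos (by linarith))]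
    linarith
  have hlen : len a b = fd a b := min_eq_left (by linarith)
  rw [hlen] at hd
  have hfd : fd a b = 1 / 3 + d ∨ fd a b = 1 / 3 - d := by
    rcases abs_choice (fd a b - 1 / 3) with h | h <;> rw [h] at hd
    · exact Or.inl (by linarith)
    · exact Or.inr (by linarith)
  have hne : a ≠ b := ne_of_fd_pos (by rcases hfd with h | h <;> linarith)
  have hs3 : s3 a ≠ s3 b := fun h => by
    rcases fiber_s3 h hne with h | h <;> rcases hfd with h' | h' <;> linarith
  have hsib : s(a + ((1 / 3 : ℝ) : S1), b + ((2 / 3 : ℝ) : S1)) ∈ L := by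
    obtain ⟨a₂, b₂, a₃, b₃, l2, l3, ea2, ea3, eb2, eb3, na12, na13, na23, nb12, nb13, nb23⟩ :=
      hL.exists_siblings hab hs3
    have key : ∀ a' b', s(a', b') ∈ L → s3 b' = s3 b → b ≠ b' → fd a a' = 1 / 3 →
        s(a + ((1 / 3 : ℝ) : S1), b + ((2 / 3 : ℝ) : S1)) ∈ L := by
      intro a' b' l' eb hb ha
      have e1 := eq_add_fd a a'
      have e2 := eq_add_fd b b'
      rw [ha] at e1
      rcases fiber_s3 eb.symm hb with h | h
      · exfalso
        have hanti : s(antip a, antip b) ∈ L := by simpa [cmap] using hL.symm _ hab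
        have q1 : fd a (antip a) = 1 / 2 := fd_add a (by norm_num) (by norm_num)
        have q2 : fd a b' = fd a b + 1 / 3 := by
          rw [e2, h, eq_add_fd a b, add_assoc, ← AddCircle.coe_add,
            fd_add a (by linarith [fd_nonneg a b]) (by linarith),
            fd_add a (fd_nonneg a b) (fd_lt_one a b)]
        have q3 : fd a (antip b) = fd a b + 1 / 2 := by
          rw [antip, eq_add_fd a b, add_assoc, ← AddCircle.coe_add,
            fd_add a (by linarith [fd_nonneg a b]) (by rcases hfd with h' | h' <;> linarith),
            fd_add a (fd_nonneg a b) (fd_lt_one a b)]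
        exact (hL.unsep l').base hanti (u := b') (v := a') (by simp) (by simp) a
          (by rw [q1, q2]; rcases hfd with h' | h' <;> linarith) (by rw [q2, q3]; linarith)
          (Or.inl (by rw [q1, ha]; norm_num))
      · rwa [e1, e2, h] at l'
    rcases fiber_s3 ea2.symm na12 with h2 | h2
    · exact key _ _ l2 eb2 nb12 h2
    rcases fiber_s3 ea3.symm na13 with h3 | h3
    · exact key _ _ l3 eb3 nb13 h3
    · exact absurd (fd_injective (h2.trans h3.symm)) na23
  have hb := eq_add_fd a b
  have h1 : ((1 : ℝ) : S1) = 0 := AddCircle.coe_period 1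
  rcases hfd with h | h
  · refine ⟨a, by rwa [← h, ← hb], ?_⟩
    rw [Sym2.eq_swap]
    convert hsib using 2
    rw [hb, h, add_assoc, ← AddCircle.coe_add, show 1 / 3 + d + 2 / 3 = d + 1 by ring,
      AddCircle.coe_add, h1, add_zero]
  · refine ⟨b + ((2 / 3 : ℝ) : S1), ?_, ?_⟩
    · rw [Sym2.eq_swap]
      convert hsib using 2
      rw [hb, h]
      simp only [add_assoc, ← AddCircle.coe_add]
      rw [show 1 / 3 - d + (2 / 3 + (1 / 3 + d)) = 1 / 3 + 1 by ring, AddCircle.coe_add, h1,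
        add_zero]
    · convert hab using 2 <;> rw [hb, h] <;> simp only [add_assoc, ← AddCircle.coe_add]
      · rw [show 1 / 3 - d + (2 / 3 + d) = 0 + 1 by ring, AddCircle.coe_add, h1,
          AddCircle.coe_zero, add_zero, add_zero]
      · rw [show 1 / 3 - d + (2 / 3 + 1 / 3) = 1 / 3 - d + 1 by ring, AddCircle.coe_add, h1,
          add_zero]

/-- A set of pairwise unseparated points containing two points at distance close to `1/3` is
contained in the union of two short arcs. -/
theorem exists_two_arcs {L : Set Chord} (hL : IsCubicSymLam L) {a b : S1} (hab : s(a, b) ∈ L)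
    {d : ℝ} (hd : |len a b - 1 / 3| = d) (h0 : 0 < d) (h6 : d < 1 / 6) {B : Set S1}
    (hB : Unsep L B) {u v : S1} (hu : u ∈ B) (hv : v ∈ B) (huv : |len u v - 1 / 3| < d) :
    ∃ c₁ c₂, ∀ x ∈ B, fd c₁ x ≤ d ∨ fd c₂ x ≤ d := by
  obtain ⟨c, l1, l2⟩ := exists_strip hL hab hd h0 h6
  have l3 : s(antip c, antip c + ((1 / 3 + d : ℝ) : S1)) ∈ L := by
    have := hL.symm _ l1
    rw [cmap, Sym2.map_mk] at this
    convert this using 2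
    unfold antip; abel
  have l4 : s(antip c + (d : S1), antip c + ((1 / 3 : ℝ) : S1)) ∈ L := by
    have := hL.symm _ l2
    rw [cmap, Sym2.map_mk] at this
    convert this using 2 <;> unfold antip <;> abel
  have pos : ∀ r : ℝ, 0 ≤ r → r < 1 / 2 → fd c (antip c + (r : S1)) = 1 / 2 + r := by
    intro r hr hr'
    rw [antip, add_assoc, ← AddCircle.coe_add, fd_add c (by linarith) (by linarith)]
  wlog hUV : fd c u < fd c v generalizing u v
  · refine this hv hu (by rwa [len_comm]) (lt_of_le_of_ne (not_lt.mp hUV) fun h => ?_)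
    obtain rfl := fd_injective h
    rw [len, fd_self, abs_lt] at huv
    norm_num at huv
    linarith
  have hlen := fd_of_le hUV.le
  have huv' := huv
  rw [len, hlen] at huv'
  have := strip_positions h0 h6 (fd_nonneg c u) (fd_lt_one c v) huv' (by
    intro s t hst
    have : ∃ p q, s(p, q) ∈ L ∧ fd c p = s ∧ fd c q = t := by
      rcases hst with ⟨rfl, rfl⟩ | ⟨rfl, rfl⟩ | ⟨rfl, rfl⟩ | ⟨rfl, rfl⟩
      · exact ⟨_, _, l1, fd_self c, fd_add c (by linarith) (by linarith)⟩
      · exact ⟨_, _, l2, fd_add c (by linarith) (by linarith),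
          fd_add c (by linarith) (by linarith)⟩
      · refine ⟨_, _, l3, fd_add c (by linarith) (by linarith), ?_⟩
        rw [pos _ (by linarith) (by linarith)]; ring
      · refine ⟨_, _, l4, pos _ (by linarith) (by linarith), ?_⟩
        rw [pos _ (by linarith) (by linarith)]; ring
    obtain ⟨p, q, l, rfl, rfl⟩ := this
    exact ⟨fun ⟨h1, h2, h3⟩ => hB.base l hu hv c h1 h2 (Or.inr h3),
      fun ⟨h1, h2, h3⟩ => hB.base l hv hu c h2 h3 (Or.inl h1)⟩)
  have hr : 1 / 3 - d < fd c v - fd c u := by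
    have := abs_lt.mp huv'
    linarith [min_le_left (fd c v - fd c u) (1 - (fd c v - fd c u))]
  have hr' : fd c v - fd c u < 1 / 3 + d := by
    have := fd_nonneg c u
    rw [min_eq_left (by grind)] at huv'
    linarith [(abs_lt.mp huv').2]
  rcases this with ⟨hU, hV, hV'⟩ | ⟨hU, hU', hV, hV'⟩
  · exact ⟨_, _, hB.subset_strip h0 h6 l1 l2 hu hv hU hV hr' hr⟩
  · have e0 : fd c (antip c) = 1 / 2 := fd_add c (by norm_num) (by norm_num)
    have e1 : fd (antip c) u = fd c u - 1 / 2 := by rw [fd_of_le (a := c) (by linarith), e0]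
    have e2 : fd (antip c) v = fd c v - 1 / 2 := by rw [fd_of_le (a := c) (by linarith), e0]
    exact ⟨_, _, hB.subset_strip h0 h6 l3 l4 hu hv (by linarith) (by linarith)
      (by linarith) (by linarith)⟩

lemma le_len_image (a b : S1) : min (len a b) (3 * |len a b - 1 / 3|) ≤ len (s3 a) (s3 b) := by
  obtain ⟨k, h0, h2, hk⟩ := fd_s3 a b
  have hX := fd_nonneg (s3 a) (s3 b)
  have hX1 := fd_lt_one (s3 a) (s3 b)
  unfold len
  rw [hk]
  generalize fd (s3 a) (s3 b) = X at *
  interval_cases k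
  all_goals push_cast
  · rw [min_eq_left (a := (X + 0) / 3) (by linarith), abs_of_nonpos (by linarith)]
    grind
  · rcases le_total X (1 / 2) with h | h
    · rw [min_eq_left (a := (X + 1) / 3) (by linarith), abs_of_nonneg (by linarith)]
      grind
    · rw [min_eq_right (a := (X + 1) / 3) (by linarith), abs_of_nonneg (by linarith)]
      grind
  · rw [min_eq_right (a := (X + 2) / 3) (by linarith), abs_of_nonpos (by linarith)]
    grind

theorem no_wandering {L : Set Chord} (hL : IsCubicSymLam L) {A : ℕ → Set S1}
    (hA : ∀ n, GapLike L (A n)) (h3 : ∀ n, HasThree (A n)) (hs : ∀ n, A (n + 1) = s3 '' A n)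
    (hinj : Function.Injective A) : False := by
  obtain ⟨N, hN⟩ := eventually_injOn hA h3 hinj
  have hiter : ∀ n k, A (n + k) = s3^[k] '' A n := by
    intro n k
    induction k with
    | zero => simp
    | succ k ih => rw [← add_assoc, hs, ih, Function.iterate_succ', Set.image_comp]
  have harc : ∀ a : S1, ∀ r > 0, ∃ x, fd a x ≤ r ∧ x ∉ A N := by
    intro a r hr
    by_contra! h
    obtain ⟨n, hn⟩ := exists_image_eq_univ hr h
    rw [← hiter] at hn
    have : A (N + n + 1) = A (N + n) := by
      rw [hs, hn, image_univ, s3_surjective.range_eq]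
    exact absurd (hinj this) (by omega)
  obtain ⟨a₀, b₀, ha₀, hab₀⟩ := exists_three_consec (hA N).closed harc (h3 N)
  set a : ℕ → Fin 3 → S1 := fun n i => s3^[n] (a₀ i)
  set b : ℕ → Fin 3 → S1 := fun n i => s3^[n] (b₀ i)
  have hsucc : ∀ n i, a (n + 1) i = s3 (a n i) ∧ b (n + 1) i = s3 (b n i) := fun n i =>
    ⟨Function.iterate_succ_apply' .., Function.iterate_succ_apply' ..⟩
  have hne : ∀ n, (∀ i, Consec (A (N + n)) (a n i) (b n i)) → ∀ i, s3 (a n i) ≠ s3 (b n i) :=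
    fun n h i hh => (h i).2.2.1 (hN (N + n) (by omega) (h i).1 (h i).2.1 hh)
  have hab : ∀ n i, Consec (A (N + n)) (a n i) (b n i) := by
    intro n
    induction n with
    | zero => exact hab₀
    | succ n ih =>
      intro i
      rw [(hsucc n i).1, (hsucc n i).2, ← add_assoc, hs]
      exact (ih i).image hL.toIsInvLam (hA _).unsep ((hA _).leaf _ _ (ih i)) (hne n ih i)
  have ha : ∀ n, Function.Injective (a n) := by
    intro n
    induction n with
    | zero => exact ha₀
    | succ n ih =>
      intro i j hij
      rw [(hsucc n i).1, (hsucc n j).1] at hij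
      exact ih (hN (N + n) (by omega) (hab n i).1 (hab n j).1 hij)
  have hleaf : ∀ n i, s(a n i, b n i) ∈ L := fun n i => (hA _).leaf _ _ (hab n i)
  have hpos : ∀ n i, 0 < |len (a n i) (b n i) - 1 / 3| := by
    intro n i
    refine abs_pos.mpr fun h => hne n (hab n) i ?_
    have h : fd (a n i) (b n i) = 1 / 3 ∨ fd (a n i) (b n i) = 2 / 3 := by
      rcases min_choice (fd (a n i) (b n i)) (1 - fd (a n i) (b n i)) with h' | h' <;>
        rw [len, h'] at h
      · exact Or.inl (by linarith)
      · exact Or.inr (by linarith)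
    have h1 : ((1 : ℝ) : S1) = 0 := AddCircle.coe_period 1
    have h2 : ((2 : ℝ) : S1) = 0 := by
      rw [show (2 : ℝ) = 1 + 1 by norm_num, AddCircle.coe_add, h1, add_zero]
    rw [eq_add_fd (a n i) (b n i)]
    rcases h with h | h <;> rw [h, s3_add_third]
    · rw [h1, add_zero]
    · rw [h2, add_zero]
  have hlen0 : ∀ n i, 0 < len (a n i) (b n i) := fun n i =>
    lt_min (fd_pos (hab n i).2.2.1) (by linarith [fd_lt_one (a n i) (b n i)])
  have hstep : ∀ n i,
      min (len (a n i) (b n i)) (3 * |len (a n i) (b n i) - 1 / 3|) ≤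
        len (a (n + 1) i) (b (n + 1) i) := by
    intro n i
    rw [(hsucc n i).1, (hsucc n i).2]
    exact le_len_image _ _
  have hlong : ∀ {e : ℝ} {k : ℕ}, (∀ i, e ≤ len (a 0 i) (b 0 i)) →
      (∀ n < k, ∀ i, e ≤ 3 * |len (a n i) (b n i) - 1 / 3|) →
      ∀ i, e ≤ len (a k i) (b k i) := by
    intro e k h0
    induction k with
    | zero => exact fun _ => h0
    | succ k ih =>
      intro h i
      exact (le_min (ih (fun n hn => h n (by omega)) i) (h k (by omega) i)).trans (hstep k i)
  obtain ⟨i₀, hi₀⟩ := Finite.exists_min fun i => len (a 0 i) (b 0 i)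
  have hclose : ∀ e > 0, e ≤ len (a 0 i₀) (b 0 i₀) / 3 →
      ∃ n i, |len (a n i) (b n i) - 1 / 3| < e := by
    intro e he he'
    by_contra! h
    obtain ⟨n, i, hni⟩ := exists_short_edge (A := fun n => A (N + n)) (fun n => hA _)
      (fun n => h3 _) (hinj.comp (add_right_injective N)) ha hab (mul_pos three_pos he)
    exact absurd hni (not_lt.mpr (hlong (k := n) (fun i => by linarith [hi₀ i])
      (fun n _ i => by linarith [h n i]) i))
  obtain ⟨n₁, i₁, h₁⟩ := hclose (min (len (a 0 i₀) (b 0 i₀) / 3) (1 / 6))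
    (lt_min (by linarith [hlen0 0 i₀]) (by norm_num)) (min_le_left _ _)
  rw [lt_min_iff] at h₁
  set d := |len (a n₁ i₁) (b n₁ i₁) - 1 / 3| with hd
  have hd0 : 0 < d := hpos n₁ i₁
  classical
  have hex := hclose d hd0 h₁.1.le
  obtain ⟨i₂, h₂⟩ := Nat.find_spec hex
  have hmin : ∀ n < Nat.find hex, ∀ i, d ≤ |len (a n i) (b n i) - 1 / 3| := fun n hn i => by
    by_contra! h
    exact Nat.find_min hex hn ⟨i, h⟩
  set k := Nat.find hex
  have hk := hlong (e := 3 * d) (k := k) (fun i => by linarith [hi₀ i, h₁.1])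
    fun n hn i => by linarith [hmin n hn i]
  obtain ⟨c₁, c₂, hc⟩ := exists_two_arcs hL (hleaf n₁ i₁) hd.symm hd0 h₁.2 (hA (N + k)).unsep
    (hab k i₂).1 (hab k i₂).2.1 h₂
  have hfar : ∀ c i j, i ≠ j → fd c (a k i) ≤ d → fd c (a k j) ≤ d → False := by
    intro c i j hij hi hj
    wlog h : fd c (a k i) ≤ fd c (a k j) generalizing i j
    · exact this j i hij.symm hj hi (le_of_not_ge h)
    have h1 := (hk i).trans ((hab k i).len_le_fd (hab k j).1 fun h => hij (ha k h))
    rw [fd_of_le h] at h1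
    linarith [fd_nonneg c (a k i)]
  rcases hc _ (hab k 0).1 with h0 | h0 <;> rcases hc _ (hab k 1).1 with h1 | h1 <;>
    rcases hc _ (hab k 2).1 with h2 | h2
  all_goals first
    | exact hfar _ 0 1 (by decide) h0 h1
    | exact hfar _ 0 2 (by decide) h0 h2
    | exact hfar _ 1 2 (by decide) h1 h2

/-! ### Gaps in the disk -/

lemma toC_coe (r : ℝ) : toC (r : S1) = Complex.exp (2 * Real.pi * Complex.I * r) := by
  have h : ((AddCircle.equivIco 1 0 (r : S1) : ℝ) : S1) = (r : S1) := AddCircle.coe_equivIco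
  obtain ⟨k, hk⟩ := coe_eq_coe h
  rw [toC, hk]
  push_cast
  rw [mul_add, Complex.exp_add, mul_comm _ (k : ℂ), Complex.exp_int_mul_two_pi_mul_I, mul_one]

lemma toC_add (a : S1) (r : ℝ) :
    toC (a + (r : S1)) = toC a * Complex.exp (2 * Real.pi * Complex.I * r) := by
  obtain ⟨t, rfl⟩ := QuotientAddGroup.mk_surjective a
  have := toC_coe (t + r)
  rw [AddCircle.coe_add] at this
  rw [this, toC_coe, ← Complex.exp_add]
  push_cast
  ring_nf

lemma toC_continuous : Continuous toC := by
  have : Continuous fun r : ℝ => toC (r : S1) := by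
    simp_rw [toC_coe]; fun_prop
  exact (QuotientAddGroup.isQuotientMap_mk _).continuous_iff.mpr this

lemma norm_toC (x : S1) : ‖toC x‖ = 1 := by
  rw [toC, Complex.norm_exp]; simp

/-- A real-affine function vanishing on the line through the endpoints of the chord `s t` and
positive to the left of this line. -/
def side (s t : S1) (z : ℂ) : ℝ := ((starRingEnd ℂ) (toC t - toC s) * (z - toC s)).im

lemma side_continuous (s t : S1) : Continuous (side s t) := by
  unfold side; fun_prop

lemma side_swap (s t : S1) (z : ℂ) : side t s z = - side s t z := by
  simp [side]; ring

lemma side_convex (s t : S1) (z w : ℂ) {α β : ℝ} (h : α + β = 1) :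
    side s t (α • z + β • w) = α * side s t z + β * side s t w := by
  obtain rfl : β = 1 - α := by linarith
  simp [side]; ring

lemma side_toC (s t x : S1) : side s t (toC x) = 4 * Real.sin (Real.pi * fd s t) *
    Real.sin (Real.pi * (fd s x - fd s t)) * Real.sin (Real.pi * fd s x) := by
  have hs : (starRingEnd ℂ) (toC s) * toC s = 1 := by
    rw [mul_comm, Complex.mul_conj, Complex.normSq_eq_norm_sq, norm_toC]; simp
  rw [side, eq_add_fd s t, eq_add_fd s x, toC_add, toC_add,
    fd_add s (fd_nonneg s t) (fd_lt_one s t), fd_add s (fd_nonneg s x) (fd_lt_one s x)]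
  generalize fd s t = f
  generalize fd s x = g
  have e : ∀ r : ℝ, Complex.exp (2 * Real.pi * Complex.I * r) =
      ⟨Real.cos (2 * (Real.pi * r)), Real.sin (2 * (Real.pi * r))⟩ := by
    intro r
    rw [show (2 * Real.pi * Complex.I * r : ℂ) = ((2 * (Real.pi * r) : ℝ) : ℂ) * Complex.I by
      push_cast; ring]
    exact Complex.ext (Complex.exp_ofReal_mul_I_re _) (Complex.exp_ofReal_mul_I_im _)
  have : (starRingEnd ℂ) (toC s * Complex.exp (2 * Real.pi * Complex.I * f) - toC s) *
      (toC s * Complex.exp (2 * Real.pi * Complex.I * g) - toC s) =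
      (starRingEnd ℂ) (Complex.exp (2 * Real.pi * Complex.I * f) - 1) *
      (Complex.exp (2 * Real.pi * Complex.I * g) - 1) := by
    simp only [map_sub, map_mul, map_one]
    linear_combination (((starRingEnd ℂ) (Complex.exp (2 * Real.pi * Complex.I * f)) - 1) *
      (Complex.exp (2 * Real.pi * Complex.I * g) - 1)) * hs
  have h : ∀ r : ℝ, Real.cos (2 * r) = 1 - 2 * Real.sin r ^ 2 := fun r => by
    rw [Real.cos_two_mul, Real.cos_sq']; ring
  rw [this, e, e, mul_sub Real.pi, Real.sin_sub, h, h, Real.sin_two_mul, Real.sin_two_mul]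
  simp
  ring

lemma sin_pi_mul_pos {r : ℝ} (h0 : 0 < r) (h1 : r < 1) : 0 < Real.sin (Real.pi * r) :=
  Real.sin_pos_of_pos_of_lt_pi (by positivity) (by nlinarith [Real.pi_pos])

lemma sin_pi_mul_neg {r : ℝ} (h0 : r < 0) (h1 : -1 < r) : Real.sin (Real.pi * r) < 0 :=
  Real.sin_neg_of_neg_of_neg_pi_lt (by nlinarith [Real.pi_pos]) (by nlinarith [Real.pi_pos])

lemma side_pos {s t x : S1} (h0 : 0 < fd s t) (h : fd s t < fd s x) : 0 < side s t (toC x) := by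
  rw [side_toC]
  have h1 := fd_lt_one s x
  have e1 := sin_pi_mul_pos h0 (h.trans h1)
  have e2 := sin_pi_mul_pos (h0.trans h) h1
  have e3 := sin_pi_mul_pos (r := fd s x - fd s t) (by linarith) (by linarith)
  positivity

lemma side_nonpos {s t x : S1} (h : fd s x ≤ fd s t) : side s t (toC x) ≤ 0 := by
  rw [side_toC]
  have hs : ∀ r, 0 ≤ r → r < 1 → 0 ≤ Real.sin (Real.pi * r) := fun r h0 h1 =>
    Real.sin_nonneg_of_nonneg_of_le_pi (by positivity) (by nlinarith [Real.pi_pos])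
  have e1 := hs _ (fd_nonneg s t) (fd_lt_one s t)
  have e2 := hs _ (fd_nonneg s x) (fd_lt_one s x)
  have e3 := hs (fd s t - fd s x) (by linarith) (by linarith [fd_lt_one s t, fd_nonneg s x])
  rw [← neg_sub, mul_neg, Real.sin_neg, mul_neg, neg_mul]
  exact neg_nonpos.mpr (by positivity)

lemma side_neg_iff {s t x : S1} :
    side s t (toC x) < 0 ↔ 0 < fd s x ∧ fd s x < fd s t := by
  constructor
  · intro h
    have hx : 0 < fd s x := by
      refine fd_pos ?_
      rintro rfl
      simp [side] at h
    refine ⟨hx, ?_⟩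
    by_contra! hle
    rcases hle.eq_or_lt with he | hlt
    · rw [← fd_injective he] at h
      simp [side] at h
      linarith
    · rcases (fd_nonneg s t).eq_or_lt with h0 | h0
      · rw [eq_of_fd_eq_zero h0.symm] at h
        simp [side] at h
      · exact absurd h (not_lt.mpr (side_pos h0 hlt).le)
  · rintro ⟨h0, h⟩
    rw [side_toC]
    have e1 := sin_pi_mul_pos (h0.trans h) (fd_lt_one s t)
    have e2 := sin_pi_mul_pos h0 (fd_lt_one s x)
    have e3 := sin_pi_mul_neg (r := fd s x - fd s t) (by linarith) (by linarith [fd_lt_one s t])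
    exact mul_neg_of_neg_of_pos (mul_neg_of_pos_of_neg (by positivity) e3) e2

lemma eq_or_eq_of_side_eq_zero {s t x : S1} (hst : s ≠ t) (h : side s t (toC x) = 0) :
    x = s ∨ x = t := by
  rcases lt_trichotomy (fd s x) (fd s t) with h1 | h1 | h1
  · rcases (fd_nonneg s x).eq_or_lt with h0 | h0
    · exact Or.inl (eq_of_fd_eq_zero h0.symm)
    · exact absurd h (side_neg_iff.mpr ⟨h0, h1⟩).ne
  · exact Or.inr (fd_injective h1)
  · exact absurd h (side_pos (fd_pos hst) h1).ne'

lemma toC_injective : Function.Injective toC := by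
  intro s t h
  by_contra hst
  have h0 := fd_pos hst
  have h1 := fd_lt_one s t
  have h2 := side_neg_iff (s := s) (t := t) (x := s + ((fd s t / 2 : ℝ) : S1))
  rw [fd_add s (by linarith) (by linarith), side, h] at h2
  simp at h2
  linarith

lemma mem_chordSet_of_side_eq_zero {s t : S1} (hst : s ≠ t) {z : ℂ} (hz : ‖z‖ < 1)
    (h : side s t z = 0) : z ∈ chordSet s(s, t) := by
  set D := toC t - toC s with hD
  have hD0 : D ≠ 0 := sub_ne_zero.mpr fun h => hst (toC_injective h).symm
  have hN : 0 < Complex.normSq D := Complex.normSq_pos.mpr hD0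
  set r := ((starRingEnd ℂ) D * (z - toC s)).re / Complex.normSq D with hr
  have hz' : z = toC s + r * D := by
    have h1 : (starRingEnd ℂ) D * (z - toC s) = (r * Complex.normSq D : ℝ) := by
      rw [hr, div_mul_cancel₀ _ hN.ne']
      exact Complex.ext rfl h
    have h2 : (Complex.normSq D : ℂ) ≠ 0 := by exact_mod_cast hN.ne'
    apply mul_left_cancel₀ h2
    push_cast at h1
    rw [← Complex.mul_conj] at h1 ⊢
    linear_combination D * h1
  have n1 : Complex.normSq (toC s) = 1 := by rw [Complex.normSq_eq_norm_sq, norm_toC]; simp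
  have n2 : Complex.normSq (toC s + D) = 1 := by
    rw [hD, add_sub_cancel, Complex.normSq_eq_norm_sq, norm_toC]; simp
  have n3 : Complex.normSq z < 1 := by
    rw [Complex.normSq_eq_norm_sq]; nlinarith [norm_nonneg z]
  have n4 : 0 < r * (1 - r) := by
    rw [hz'] at n3
    rw [Complex.normSq_apply] at n1 n2 n3 hN
    simp at n2 n3
    have n5 : r * (1 - r) * (D.re * D.re + D.im * D.im) > 0 := by
      linear_combination n3 - r * n2 - (1 - r) * n1
    exact pos_of_mul_pos_left n5 hN.le
  have : 0 ≤ r ∧ r ≤ 1 := by constructor <;> nlinarith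
  refine ⟨1 - r, r, by linarith, this.1, by ring, ?_⟩
  rw [hz', hD]
  simp
  ring

lemma side_eq_zero_of_mem_chordSet {s t : S1} {z : ℂ} (h : z ∈ chordSet s(s, t)) :
    side s t z = 0 := by
  obtain ⟨α, β, -, -, hαβ, rfl⟩ := h
  rw [side_convex _ _ _ _ hαβ]
  simp [side]
  ring_nf
  simp

lemma mem_openDisk {z : ℂ} : z ∈ openDisk ↔ ‖z‖ < 1 := by simp [openDisk]

lemma toC_notMem_openDisk (x : S1) : toC x ∉ openDisk := by simp [mem_openDisk, norm_toC]

lemma chordSet_subset_unionSet {L : Set Chord} {ℓ : Chord} (h : ℓ ∈ L) :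
    chordSet ℓ ⊆ unionSet L := fun _ hz => mem_biUnion h hz

/-- A connected set in the open disk avoiding the leaves lies on one side of every leaf. -/
lemma side_pos_of_closure {L : Set Chord} {U : Set ℂ} (hU : IsPreconnected U)
    (hUL : U ⊆ openDisk \ unionSet L) {p q : S1} (hpq : s(p, q) ∈ L) {z w : ℂ}
    (hz : z ∈ closure U) (hw : w ∈ closure U) (h : side p q z < 0) : side p q w ≤ 0 := by
  by_contra! hw0
  have hne : p ≠ q := by
    rintro rfl
    simp [side] at h
  obtain ⟨z', h1, hz'⟩ := mem_closure_iff.mp hz _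
    (isOpen_Iio.preimage (side_continuous p q)) h
  obtain ⟨w', h2, hw'⟩ := mem_closure_iff.mp hw _
    (isOpen_Ioi.preimage (side_continuous p q)) hw0
  obtain ⟨x, hx, hx0⟩ := hU.intermediate_value hz' hw' (side_continuous p q).continuousOn
    (show (0 : ℝ) ∈ Icc _ _ from ⟨le_of_lt h1, le_of_lt h2⟩)
  exact (hUL hx).2 (chordSet_subset_unionSet hpq
    (mem_chordSet_of_side_eq_zero hne (mem_openDisk.mp (hUL hx).1) hx0))

lemma Unsep.of_closure {L : Set Chord} {U : Set ℂ} (hU : IsPreconnected U)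
    (hUL : U ⊆ openDisk \ unionSet L) : Unsep L (gapVerts (closure U)) := by
  intro p q hpq u hu v hv h0 h1
  have h2 := side_pos_of_closure hU hUL hpq hu hv (side_neg_iff.mpr ⟨h0, h1⟩)
  by_contra! h3
  exact absurd h2 (not_le.mpr (side_pos (h0.trans h1) h3))

/-- Every point of the circle outside a gap is cut off from the gap by a leaf. -/
lemma exists_separating_leaf {L : Set Chord} {z : ℂ} (hz : z ∈ openDisk \ unionSet L) {c : S1}
    (hc : c ∉ gapVerts (closure (connectedComponentIn (openDisk \ unionSet L) z))) :
    ∃ p q, s(p, q) ∈ L ∧ 0 < fd p c ∧ fd p c < fd p q ∧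
      ∀ v ∈ gapVerts (closure (connectedComponentIn (openDisk \ unionSet L) z)),
        0 < fd p v → fd p q ≤ fd p v := by
  set U := connectedComponentIn (openDisk \ unionSet L) z
  have hzU : z ∈ U := mem_connectedComponentIn hz
  have hUL : U ⊆ openDisk \ unionSet L := connectedComponentIn_subset _ _
  have hUc : IsPreconnected U := isPreconnected_connectedComponentIn
  set γ : ℝ → ℂ := fun τ => (1 - τ) • z + τ • toC c with hγ
  have hγc : Continuous γ := by fun_prop
  have hγd : ∀ τ ∈ Ico (0 : ℝ) 1, γ τ ∈ openDisk := by
    rintro τ ⟨h0, h1⟩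
    rw [mem_openDisk]
    have hz1 := mem_openDisk.mp hz.1
    calc ‖γ τ‖ ≤ ‖(1 - τ) • z‖ + ‖τ • toC c‖ := norm_add_le _ _
      _ = (1 - τ) * ‖z‖ + τ := by
        rw [norm_smul, norm_smul, norm_toC, Real.norm_of_nonneg h0,
          Real.norm_of_nonneg (by linarith), mul_one]
      _ < 1 := by nlinarith
  have hblock : ∃ τ ∈ Ico (0 : ℝ) 1, γ τ ∈ unionSet L := by
    by_contra! h
    apply hc
    have hsub : γ '' Ico 0 1 ⊆ U := by
      refine (isPreconnected_Ico.image _ hγc.continuousOn).subset_connectedComponentIn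
        ⟨0, by simp, by simp [hγ]⟩ ?_
      rintro _ ⟨τ, hτ, rfl⟩
      exact ⟨hγd τ hτ, h τ hτ⟩
    have h1 : (1 : ℝ) ∈ closure (Ico (0 : ℝ) 1) := by
      rw [closure_Ico (by norm_num)]; simp
    have := closure_mono hsub (image_closure_subset_closure_image hγc ⟨1, h1, rfl⟩)
    have h2 : γ 1 = toC c := by simp [hγ]
    rwa [h2] at this
  obtain ⟨τ, ⟨hτ0, hτ1⟩, hτ⟩ := hblock
  obtain ⟨ℓ, hℓ, hτℓ⟩ := mem_iUnion₂.mp hτ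
  induction ℓ using Sym2.ind with
  | _ p q =>
  have hpq : p ≠ q := by
    rintro rfl
    have : γ τ = toC p := by simpa [chordSet] using hτℓ
    exact toC_notMem_openDisk p (this ▸ hγd τ ⟨hτ0, hτ1⟩)
  have hz0 : side p q z ≠ 0 := fun h => hz.2 (chordSet_subset_unionSet hℓ
    (mem_chordSet_of_side_eq_zero hpq (mem_openDisk.mp hz.1) h))
  wlog hzs : 0 < side p q z generalizing p q
  · refine this q p (by rwa [Sym2.eq_swap]) (by rwa [Sym2.eq_swap]) hpq.symm ?_ ?_ <;>
      rw [side_swap]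
    · exact neg_ne_zero.mpr hz0
    · exact neg_pos.mpr (lt_of_le_of_ne (not_lt.mp hzs) hz0)
  have hsum := side_eq_zero_of_mem_chordSet hτℓ
  rw [hγ, side_convex _ _ _ _ (by ring)] at hsum
  have hcs : side p q (toC c) < 0 := by
    by_contra! h
    nlinarith [mul_nonneg hτ0 h, mul_pos (sub_pos.mpr hτ1) hzs]
  obtain ⟨h0, h1⟩ := side_neg_iff.mp hcs
  refine ⟨p, q, hℓ, h0, h1, fun v hv hv0 => ?_⟩
  by_contra! hv1
  exact absurd (side_pos_of_closure hUc hUL hℓ hv (subset_closure hzU)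
    (side_neg_iff.mpr ⟨hv0, hv1⟩)) (not_le.mpr hzs)

/-- Nondegenerate limits of leaves are leaves. -/
lemma IsLamination.mem_of_mem_closure {L : Set Chord} (hL : IsLamination L) {p q : S1} (h : p ≠ q)
    (hc : (p, q) ∈ closure {x : S1 × S1 | s(x.1, x.2) ∈ L}) : s(p, q) ∈ L := by
  set m := (1 / 2 : ℝ) • toC p + (1 / 2 : ℝ) • toC q with hm
  have hm1 : ‖m‖ < 1 := by
    have := combo_mem_ball_of_ne (z := (0 : ℂ)) (r := 1) (by simp [norm_toC]) (by simp [norm_toC])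
      (toC_injective.ne h) one_half_pos one_half_pos (by norm_num)
    exact mem_ball_zero_iff.mp this
  have hmL : m ∈ unionSet L := by
    have hf : Continuous fun x : S1 × S1 => (1 / 2 : ℝ) • toC x.1 + (1 / 2 : ℝ) • toC x.2 := by
      have := toC_continuous
      fun_prop
    rw [← hL.closed.closure_eq]
    have hmaps : MapsTo _ {x : S1 × S1 | s(x.1, x.2) ∈ L} (unionSet L) := fun x hx =>
      chordSet_subset_unionSet hx ⟨1 / 2, 1 / 2, by norm_num, by norm_num, by norm_num, rfl⟩
    have := map_mem_closure hf hc hmaps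
    exact this
  obtain ⟨ℓ, hℓ, hmℓ⟩ := mem_iUnion₂.mp hmL
  induction ℓ using Sym2.ind with
  | _ u v =>
  wlog hneg : side u v (toC p) ≤ 0 generalizing u v
  · refine this v u (by rwa [Sym2.eq_swap]) (by rwa [Sym2.eq_swap]) ?_
    rw [side_swap]
    linarith
  have huv : u ≠ v := by
    rintro rfl
    have : m = toC u := by simpa [chordSet] using hmℓ
    rw [this, norm_toC] at hm1
    exact lt_irrefl _ hm1
  have hsum := side_eq_zero_of_mem_chordSet hmℓ
  rw [hm, side_convex _ _ _ _ (by norm_num)] at hsum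
  rcases hneg.eq_or_lt with hp | hneg
  · have hq : side u v (toC q) = 0 := by rw [hp] at hsum; linarith
    rcases eq_or_eq_of_side_eq_zero huv hp with rfl | rfl <;>
      rcases eq_or_eq_of_side_eq_zero huv hq with rfl | rfl
    · exact absurd rfl h
    · exact hℓ
    · rwa [Sym2.eq_swap]
    · exact absurd rfl h
  have hpos : 0 < side u v (toC q) := by linarith
  have hopen : IsOpen {x : S1 × S1 | side u v (toC x.1) < 0 ∧ 0 < side u v (toC x.2)} :=
    (isOpen_Iio.preimage ((side_continuous u v).comp (toC_continuous.comp continuous_fst))).inter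
      (isOpen_Ioi.preimage ((side_continuous u v).comp (toC_continuous.comp continuous_snd)))
  obtain ⟨⟨x, y⟩, ⟨hx, hy⟩, hxy⟩ := mem_closure_iff.mp hc _ hopen ⟨hneg, hpos⟩
  obtain ⟨h0, h1⟩ := side_neg_iff.mp hx
  have := hL.unsep hxy u v hℓ x (by simp) y (by simp) h0 h1
  exact absurd hy (not_lt.mpr (side_nonpos this))

/-- A leaf cutting off a point between two consecutive vertices of a gap has its endpoints between
these vertices. -/
lemma Consec.leaf_position {V : Set S1} {a b : S1} (h : Consec V a b) {p q c : S1}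
    (h0 : 0 < fd p c) (h1 : fd p c < fd p q) (hV : ∀ v ∈ V, 0 < fd p v → fd p q ≤ fd p v)
    (hc : fd a c < fd a b) : fd a p < fd a c ∧ fd a c < fd a q ∧ fd a q ≤ fd a b := by
  have ha := hV a h.1
  have hb := hV b h.2.1
  have b0 := fd_nonneg a p
  have b1 := fd_nonneg a q
  have b2 := fd_nonneg a c
  have b3 := fd_lt_one a p
  have b4 := fd_lt_one a q
  have b5 := fd_lt_one a b
  have hap : fd p a = if fd a p = 0 then 0 else 1 - fd a p := by
    split_ifs with h
    · rw [eq_of_fd_eq_zero h, fd_self]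
    · exact fd_swap fun h' => h (h' ▸ fd_self a)
  rw [hap] at ha
  rcases fd_cases a p c with ⟨c1, c2⟩ | ⟨c1, c2⟩ <;>
    rcases fd_cases a p q with ⟨d1, d2⟩ | ⟨d1, d2⟩ <;>
    rcases fd_cases a p b with ⟨e1, e2⟩ | ⟨e1, e2⟩ <;> grind

/-- Consecutive vertices of a gap are joined by a leaf. -/
theorem IsLamination.leaf_of_consec {L : Set Chord} (hL : IsLamination L) {V : Set S1}
    (hV : ∀ c ∉ V, ∃ p q, s(p, q) ∈ L ∧ 0 < fd p c ∧ fd p c < fd p q ∧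
      ∀ v ∈ V, 0 < fd p v → fd p q ≤ fd p v) {a b : S1} (h : Consec V a b) : s(a, b) ∈ L := by
  set f := fd a b with hf
  have hf0 : 0 < f := fd_pos h.2.2.1
  have hf1 : f < 1 := fd_lt_one a b
  have key : ∀ r, 0 < r → r < f → ∃ σ τ : ℝ, 0 ≤ σ ∧ σ < r ∧ r < τ ∧ τ ≤ f ∧
      s(a + (σ : S1), a + (τ : S1)) ∈ L := by
    intro r hr hrf
    have hc : fd a (a + (r : S1)) = r := fd_add a hr.le (hrf.trans hf1)
    obtain ⟨p, q, l, h0, h1, h2⟩ := hV (a + (r : S1)) fun hm => by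
      have := h.2.2.2 _ hm (by rwa [hc])
      linarith
    obtain ⟨g0, g1, g2⟩ := h.leaf_position h0 h1 h2 (by rwa [hc])
    rw [hc] at g0 g1
    exact ⟨fd a p, fd a q, fd_nonneg a p, g0, g1, g2, by rwa [← eq_add_fd, ← eq_add_fd]⟩
  obtain ⟨σ₀, τ₀, h0, h1, h2, h3, h4⟩ := key (f / 2) (by linarith) (by linarith)
  set φ : ℝ × ℝ → S1 × S1 := fun x => (a + (x.1 : S1), a + (x.2 : S1)) with hφ
  have hφc : Continuous φ := by
    have := AddCircle.continuous_mk' (1 : ℝ)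
    exact (continuous_const.add (this.comp continuous_fst)).prodMk
      (continuous_const.add (this.comp continuous_snd))
  set K : Set (ℝ × ℝ) := (Icc 0 (f / 2) ×ˢ Icc (f / 2) f) ∩
    ({x | τ₀ - σ₀ ≤ x.2 - x.1} ∩ {x | s((φ x).1, (φ x).2) ∈ L}) with hK
  have hKc : IsCompact K := by
    have : K = (Icc 0 (f / 2) ×ˢ Icc (f / 2) f) ∩
        ({x | τ₀ - σ₀ ≤ x.2 - x.1} ∩ φ ⁻¹' closure {x : S1 × S1 | s(x.1, x.2) ∈ L}) := by
      ext ⟨σ, τ⟩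
      refine and_congr_right fun hx => and_congr_right fun hx' => ⟨fun h => subset_closure h,
        fun h => hL.mem_of_mem_closure ?_ h⟩
      rw [Set.mem_ofPred_eq] at hx'
      obtain ⟨⟨x1, x2⟩, x3, x4⟩ := hx
      dsimp only at hx' x1 x2 x3 x4
      intro he
      have e1 := fd_add a x1 (by linarith : σ < 1)
      have e2 := fd_add a (by linarith : 0 ≤ τ) (by linarith)
      have : fd a (a + (σ : S1)) = fd a (a + (τ : S1)) := congrArg _ he
      linarith
    rw [this]
    refine (isCompact_Icc.prod isCompact_Icc).inter_right (IsClosed.inter ?_ ?_)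
    · exact isClosed_le continuous_const (continuous_snd.sub continuous_fst)
    · exact isClosed_closure.preimage hφc
  have hK0 : (σ₀, τ₀) ∈ K := ⟨⟨⟨h0, h1.le⟩, h2.le, h3⟩, le_refl (τ₀ - σ₀), h4⟩
  obtain ⟨⟨σ, τ⟩, ⟨⟨⟨x1, x2⟩, x3, x4⟩, x5, x6⟩, hmax⟩ := hKc.exists_isMaxOn ⟨_, hK0⟩
    (continuous_snd.sub continuous_fst).continuousOn
  dsimp only at x1 x2 x3 x4
  rw [Set.mem_ofPred_eq] at x5 x6
  dsimp only at x5
  have e1 := fd_add a x1 (by linarith : σ < 1)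
  have e2 := fd_add a (by linarith : 0 ≤ τ) (by linarith)
  have grow : ∀ σ' τ' : ℝ, 0 ≤ σ' → τ' ≤ f → s(a + (σ' : S1), a + (τ' : S1)) ∈ L →
      σ' ≤ σ → τ ≤ τ' → τ' - σ' ≤ τ - σ := by
    intro σ' τ' y1 y2 y3 y4 y5
    exact hmax (a := (σ', τ')) ⟨⟨⟨y1, by linarith⟩, by linarith, y2⟩,
      by rw [Set.mem_ofPred_eq]; linarith, y3⟩
  have hσ : σ = 0 := by
    by_contra hne
    obtain ⟨σ', τ', y0, y1, y2, y3, y4⟩ := key σ (lt_of_le_of_ne x1 (Ne.symm hne)) (by linarith)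
    have e3 := fd_add a y0 (by linarith : σ' < 1)
    have e4 := fd_add a (by linarith : 0 ≤ τ') (by linarith)
    have : τ ≤ τ' := by
      by_contra! hlt
      exact (hL.unsep x6).base y4 (u := a + (σ : S1)) (v := a + (τ : S1)) (by simp [hφ])
        (by simp [hφ]) a (by rwa [e1, e3]) (by rwa [e1, e4]) (Or.inr (by rwa [e2, e4]))
    linarith [grow σ' τ' y0 y3 y4 y1.le this]
  have hτ : τ = f := by
    by_contra hne
    obtain ⟨σ', τ', y0, y1, y2, y3, y4⟩ := key τ (by linarith) (lt_of_le_of_ne x4 hne)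
    have e3 := fd_add a y0 (by linarith : σ' < 1)
    have e4 := fd_add a (by linarith : 0 ≤ τ') (by linarith)
    have : σ' ≤ σ := by
      by_contra! hlt
      exact (hL.unsep x6).base y4 (u := a + (τ : S1)) (v := a + (σ : S1)) (by simp [hφ])
        (by simp [hφ]) a (by rwa [e2, e3]) (by rwa [e2, e4]) (Or.inl (by rwa [e1, e3]))
    linarith [grow σ' τ' y0 y3 y4 this y2.le]
  simp only [hφ, hσ, hτ, hf, ← eq_add_fd, AddCircle.coe_zero, add_zero] at x6
  exact x6

theorem IsGapOf.gapLike {L : Set Chord} (hL : IsLamination L) {G : Set ℂ} (hG : IsGapOf L G) :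
    GapLike L (gapVerts G) := by
  obtain ⟨z, hz, rfl⟩ := hG
  exact ⟨isClosed_closure.preimage toC_continuous,
    Unsep.of_closure isPreconnected_connectedComponentIn (connectedComponentIn_subset _ _),
    fun a b h => hL.leaf_of_consec (fun c hc => exists_separating_leaf hz hc) h⟩

lemma gapVerts_convexHull (W : Set S1) : gapVerts (convexHull ℝ (toC '' W)) = W := by
  ext x
  refine ⟨fun hx => ?_, fun hx => subset_convexHull ℝ _ ⟨x, hx, rfl⟩⟩
  by_contra hxW
  have hconv : Convex ℝ {z : ℂ | inner ℝ (toC x) z < 1} :=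
    convex_halfSpace_lt (innerSL ℝ (toC x)).isLinear 1
  have hsub : toC '' W ⊆ {z : ℂ | inner ℝ (toC x) z < 1} := by
    rintro _ ⟨y, hy, rfl⟩
    exact (inner_lt_one_iff_real_of_norm_eq_one (norm_toC x) (norm_toC y)).mpr
      (toC_injective.ne (by rintro rfl; exact hxW hy))
  have := convexHull_min hsub hconv hx
  rw [Set.mem_ofPred_eq, real_inner_self_eq_norm_sq, norm_toC] at this
  norm_num at this

lemma gapIter_succ (n : ℕ) (G : Set ℂ) :
    gapIter (n + 1) G = convexHull ℝ (toC '' (s3^[n + 1] '' gapVerts G)) := by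
  induction n with
  | zero => rfl
  | succ n ih =>
    rw [gapIter, Function.iterate_succ_apply', ← gapIter, ih, gapImage, gapVerts_convexHull,
      Function.iterate_succ' s3 (n + 1), Set.image_comp]

lemma exists_pair_of_not_hasThree {A : Set S1} (h : ¬ HasThree A) (hne : A.Nonempty) :
    ∃ x y, A = {x, y} := by
  obtain ⟨x, hx⟩ := hne
  by_cases h2 : ∃ y ∈ A, x ≠ y
  · obtain ⟨y, hy, hxy⟩ := h2
    refine ⟨x, y, Subset.antisymm (fun z hz => ?_) (by rintro _ (rfl | rfl) <;> assumption)⟩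
    by_contra hz'
    simp only [mem_insert_iff, mem_singleton_iff, not_or] at hz'
    exact h ⟨x, hx, y, hy, z, hz, hxy, Ne.symm hz'.1, Ne.symm hz'.2⟩
  · push Not at h2
    exact ⟨x, x, Subset.antisymm (fun z hz => by simp [h2 z hz]) (by simpa using hx)⟩

theorem gap_preperiodic :
    ∀ (L : Set Chord) (G : Set ℂ), IsCubicSymLam L → IsGapOf L G →
      (∃ (n : ℕ) (c : Chord), gapIter n G = chordSet c) ∨
      (∃ k p : ℕ, 1 ≤ p ∧ gapIter (k + p) G = gapIter k G) := by
  intro L G hL hG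
  have hgap : ∀ n, GapLike L (s3^[n] '' gapVerts G) := by
    intro n
    induction n with
    | zero => simpa using hG.gapLike hL.toIsLamination
    | succ n ih =>
      rw [Function.iterate_succ', Set.image_comp]
      exact ih.image hL.toIsInvLam
  by_cases h3 : ∀ n, HasThree (s3^[n + 1] '' gapVerts G)
  · right
    by_contra! hne
    refine no_wandering hL (fun n => hgap (n + 1)) h3 (fun n => ?_) fun n m hnm => ?_
    · rw [Function.iterate_succ' s3 (n + 1), Set.image_comp]
    · replace hnm : gapIter (n + 1) G = gapIter (m + 1) G := by
        rw [gapIter_succ, gapIter_succ]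
        exact congrArg _ (congrArg _ hnm)
      by_contra hnm'
      wlog hlt : n < m generalizing n m
      · exact this m n hnm.symm (Ne.symm hnm') (by omega)
      refine hne (n + 1) (m - n) (by omega) ?_
      rw [hnm, show n + 1 + (m - n) = m + 1 by omega]
  · push Not at h3
    obtain ⟨n, hn⟩ := h3
    rcases Set.eq_empty_or_nonempty (gapVerts G) with h0 | h0
    · exact Or.inr ⟨1, 1, le_rfl, by rw [gapIter_succ, gapIter_succ, h0]; simp⟩
    · obtain ⟨x, y, hxy⟩ := exists_pair_of_not_hasThree hn (h0.image _)
      refine Or.inl ⟨n + 1, s(x, y), ?_⟩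
      rw [gapIter_succ, hxy, Set.image_pair, convexHull_pair]
      rfl

end
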